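/- Let 2 < q < ∞, set α := (q−2)/(2q+2), and let 1 < p < 2. There exist a universal constant c₁ > 0 and a constant C = C(p, q) such that the following holds. Let n, m₀, k be positive integers with √q·n^{1−α}(log n)^{(1−2α)/3} ≤ m₀ ≤ n and k ≤ c₁·m₀/(q^{1/2}·n^{1−α}(log n)^{(1−2α)/3}). Then there exists an n-dimensional real normed space Y with type p constant T_p(Y) ≤ C and cotype q constant C_q(Y) ≤ C, such that for every integer m with m₀ ≤ m ≤ n, every m-dimensional subspace Ỹ of Y, and every p₁ with p < p₁ < 2, the type p₁ constant of Ỹ satisfies T_{p₁}(Ỹ) ≥ (1/2)·k^{1/p − 1/p₁}. -/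

import Mathlib

open Finset

/-- The Rademacher average `2^{-M} ∑_{ε ∈ {-1,1}^M} ‖∑ i ε_i x_i‖²`. -/
noncomputable def radAvg {X : Type*} [SeminormedAddCommGroup X] [NormedSpace ℝ X]
    {M : ℕ} (x : Fin M → X) : ℝ :=
  ((2:ℝ)^M)⁻¹ * ∑ ε : Fin M → Bool, ‖∑ i, (if ε i then (1:ℝ) else -1) • x i‖^2

/-- The cotype-`q` constant `C_q(X)`: the smallest `C ≥ 0` such that
`(∑ ‖x_i‖^q)^{1/q} ≤ C (2^{-M} ∑_ε ‖∑ ε_i x_i‖²)^{1/2}` for all finite sequences. -/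
noncomputable def cotypeConst (q : ℝ) (X : Type*) [SeminormedAddCommGroup X]
    [NormedSpace ℝ X] : ℝ :=
  sInf {C : ℝ | 0 ≤ C ∧ ∀ (M : ℕ) (x : Fin M → X),
    (∑ i, ‖x i‖ ^ q) ^ (1 / q) ≤ C * Real.sqrt (radAvg x)}

/-- The type-`p` constant `T_p(X)`: the smallest `T ≥ 0` such that
`(2^{-M} ∑_ε ‖∑ ε_i x_i‖²)^{1/2} ≤ T (∑ ‖x_i‖^p)^{1/p}` for all finite sequences. -/
noncomputable def typeConst (p : ℝ) (X : Type*) [SeminormedAddCommGroup X]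
    [NormedSpace ℝ X] : ℝ :=
  sInf {T : ℝ | 0 ≤ T ∧ ∀ (M : ℕ) (x : Fin M → X),
    Real.sqrt (radAvg x) ≤ T * (∑ i, ‖x i‖ ^ p) ^ (1 / p)}

/-- The sign `±1` of a Boolean. -/
noncomputable def sgn (b : Bool) : ℝ := if b then 1 else -1

lemma two_point_of_le {a b h₁ h₂ : ℝ} (hab : b ≤ a)
    (H₁ : ∀ θ : ℝ, 0 ≤ θ → θ ≤ 1 → h₁ ≤ (1 - θ) * a + θ * b + θ ^ 2 / 8) (H₂ : h₂ ≤ b) :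
    (Real.exp h₁ + Real.exp h₂) * (Real.exp (-a) + Real.exp (-b)) ≤ 4 := by
  obtain ⟨d, rfl⟩ : ∃ d, a = b + d := ⟨a - b, by ring⟩
  have hd : 0 ≤ d := by linarith
  have key : ∀ s : ℝ, h₁ ≤ b + s →
      (Real.exp h₁ + Real.exp h₂) * (Real.exp (-(b + d)) + Real.exp (-b)) ≤
      (Real.exp s + 1) * (Real.exp (-d) + 1) := by
    intro s hs
    have e1 : Real.exp h₁ ≤ Real.exp b * Real.exp s := by
      rw [← Real.exp_add]; exact Real.exp_le_exp.2 hs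
    have e2 : Real.exp h₂ ≤ Real.exp b := Real.exp_le_exp.2 H₂
    have e3 : Real.exp (-(b + d)) = Real.exp (-b) * Real.exp (-d) := by
      rw [← Real.exp_add]; ring_nf
    have e4 : Real.exp b * Real.exp (-b) = 1 := by rw [← Real.exp_add]; simp
    calc _ ≤ (Real.exp b * Real.exp s + Real.exp b) *
          (Real.exp (-(b + d)) + Real.exp (-b)) := by gcongr
      _ = (Real.exp b * Real.exp (-b)) * ((Real.exp s + 1) * (Real.exp (-d) + 1)) := by
          rw [e3]; ring
      _ = _ := by rw [e4, one_mul]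
  rcases le_total d (1 / 4) with h | h
  · refine (key (d - 2 * d ^ 2) ?_).trans ?_
    · have := H₁ (4 * d) (by linarith) (by linarith)
      nlinarith
    · have e : (Real.exp (d - 2 * d ^ 2) + 1) * (Real.exp (-d) + 1) =
          Real.exp (-(2 * d ^ 2)) + Real.exp (d - 2 * d ^ 2) + Real.exp (-d) + 1 := by
        have : Real.exp (d - 2 * d ^ 2) * Real.exp (-d) = Real.exp (-(2 * d ^ 2)) := by
          rw [← Real.exp_add]; ring_nf
        linear_combination this
      have hq : ∀ x : ℝ, |x| ≤ 1 → Real.exp x ≤ 1 + x + x ^ 2 := fun x hx => by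
        have := abs_le.1 (Real.abs_exp_sub_one_sub_id_le hx)
        linarith [this.2]
      have b1 := hq (-(2 * d ^ 2)) (by rw [abs_le]; constructor <;> nlinarith)
      have b2 := hq (d - 2 * d ^ 2) (by rw [abs_le]; constructor <;> nlinarith)
      have b3 := hq (-d) (by rw [abs_le]; constructor <;> nlinarith)
      rw [e]
      have : d ^ 2 * (-2 - 4 * d + 8 * d ^ 2) ≤ 0 :=
        mul_nonpos_of_nonneg_of_nonpos (by positivity) (by nlinarith)
      nlinarith
  · refine (key (1 / 8) ?_).trans ?_
    · have := H₁ 1 (by norm_num) le_rfl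
      linarith
    · have h1 : Real.exp (1 / 8) ≤ 1 + 1 / 8 + (1 / 8) ^ 2 := by
        have := abs_le.1 (Real.abs_exp_sub_one_sub_id_le
          (show |(1 / 8 : ℝ)| ≤ 1 by rw [abs_le]; constructor <;> norm_num))
        linarith [this.2]
      have h2 : Real.exp (-d) ≤ 1 - 1 / 4 + (1 / 4) ^ 2 := by
        have := abs_le.1 (Real.abs_exp_sub_one_sub_id_le
          (show |(-(1 / 4) : ℝ)| ≤ 1 by rw [abs_le]; constructor <;> norm_num))
        have h3 : Real.exp (-d) ≤ Real.exp (-(1 / 4)) := Real.exp_le_exp.2 (by linarith)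
        linarith [this.2]
      have p1 := Real.exp_pos (1 / 8)
      have p2 := Real.exp_pos (-d)
      nlinarith

/-- Two-point inequality behind the infimum-convolution bound on the discrete cube. -/
lemma two_point {a b h₁ h₂ : ℝ}
    (H₁ : ∀ θ : ℝ, 0 ≤ θ → θ ≤ 1 → h₁ ≤ (1 - θ) * a + θ * b + θ ^ 2 / 8)
    (H₂ : ∀ θ : ℝ, 0 ≤ θ → θ ≤ 1 → h₂ ≤ (1 - θ) * b + θ * a + θ ^ 2 / 8) :
    (Real.exp h₁ + Real.exp h₂) * (Real.exp (-a) + Real.exp (-b)) ≤ 4 := by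
  rcases le_total b a with h | h
  · exact two_point_of_le h H₁ (by simpa using H₂ 0 le_rfl zero_le_one)
  · have := two_point_of_le h H₂ (by simpa using H₁ 0 le_rfl zero_le_one)
    linarith

/-- Infimum convolution with the quadratic cost `|x - y|² / 32`. -/
noncomputable def infConv {d : ℕ} (f : (Fin d → ℝ) → ℝ) (x : Fin d → ℝ) : ℝ :=
  ⨅ y : Fin d → ℝ, (f y + (∑ i, (x i - y i) ^ 2) / 32)

lemma infConv_le {d : ℕ} {f : (Fin d → ℝ) → ℝ} (hf : ∀ x, 0 ≤ f x) (x y : Fin d → ℝ) :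
    infConv f x ≤ f y + (∑ i, (x i - y i) ^ 2) / 32 := by
  refine ciInf_le ⟨0, ?_⟩ y
  rintro _ ⟨z, rfl⟩
  have := hf z
  have : 0 ≤ ∑ i, (x i - z i) ^ 2 := Finset.sum_nonneg fun i _ => sq_nonneg _
  simp only
  positivity

lemma cons_convex_comb {d : ℕ} (y₀ y₁ θ : ℝ) (z₀ z₁ : Fin d → ℝ) :
    (Fin.cons ((1 - θ) * y₀ + θ * y₁) ((1 - θ) • z₀ + θ • z₁) : Fin (d + 1) → ℝ) =
      (1 - θ) • (Fin.cons y₀ z₀ : Fin (d + 1) → ℝ) + θ • (Fin.cons y₁ z₁ : Fin (d + 1) → ℝ) := by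
  ext i
  refine Fin.cases ?_ (fun j => ?_) i <;> simp

lemma infConv_slice_convex {d : ℕ} {f : (Fin (d + 1) → ℝ) → ℝ} (hc : ConvexOn ℝ Set.univ f)
    (hf : ∀ x, 0 ≤ f x) (x : Fin d → ℝ) (y₀ y₁ θ : ℝ) (h0 : 0 ≤ θ) (h1 : θ ≤ 1) :
    infConv (fun z => f (Fin.cons ((1 - θ) * y₀ + θ * y₁) z)) x ≤
      (1 - θ) * infConv (fun z => f (Fin.cons y₀ z)) x +
        θ * infConv (fun z => f (Fin.cons y₁ z)) x := by
  refine le_of_forall_pos_le_add fun ε hε => ?_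
  obtain ⟨z₀, hz₀⟩ := exists_lt_of_ciInf_lt
    (lt_add_of_pos_right (infConv (fun z => f (Fin.cons y₀ z)) x) hε)
  obtain ⟨z₁, hz₁⟩ := exists_lt_of_ciInf_lt
    (lt_add_of_pos_right (infConv (fun z => f (Fin.cons y₁ z)) x) hε)
  have hle := infConv_le (f := fun z => f (Fin.cons ((1 - θ) * y₀ + θ * y₁) z))
    (fun z => hf _) x ((1 - θ) • z₀ + θ • z₁)
  have hcv := hc.2 (Set.mem_univ (Fin.cons y₀ z₀)) (Set.mem_univ (Fin.cons y₁ z₁))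
    (sub_nonneg.2 h1) h0 (by ring)
  rw [← cons_convex_comb] at hcv
  have hsq : ∑ i, (x i - ((1 - θ) • z₀ + θ • z₁) i) ^ 2 ≤
      (1 - θ) * ∑ i, (x i - z₀ i) ^ 2 + θ * ∑ i, (x i - z₁ i) ^ 2 := by
    rw [Finset.mul_sum, Finset.mul_sum, ← Finset.sum_add_distrib]
    refine Finset.sum_le_sum fun i _ => ?_
    simp only [Pi.add_apply, Pi.smul_apply, smul_eq_mul]
    nlinarith [mul_nonneg (mul_nonneg h0 (sub_nonneg.2 h1)) (sq_nonneg (z₀ i - z₁ i))]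
  simp only [smul_eq_mul] at hcv
  have e0 := mul_le_mul_of_nonneg_left hz₀.le (sub_nonneg.2 h1)
  have e1 := mul_le_mul_of_nonneg_left hz₁.le h0
  simp only at hle e0 e1
  linarith

/-- Log-convexity of finite exponential sums. -/
lemma sum_exp_convex_comb {ι : Type*} [Fintype ι] [Nonempty ι] (a b : ι → ℝ) (θ : ℝ)
    (h0 : 0 ≤ θ) (h1 : θ ≤ 1) :
    Real.log (∑ i, Real.exp ((1 - θ) * a i + θ * b i)) ≤
      (1 - θ) * Real.log (∑ i, Real.exp (a i)) + θ * Real.log (∑ i, Real.exp (b i)) := by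
  have hA : 0 < ∑ i, Real.exp (a i) := Finset.sum_pos (fun i _ => Real.exp_pos _) univ_nonempty
  have hB : 0 < ∑ i, Real.exp (b i) := Finset.sum_pos (fun i _ => Real.exp_pos _) univ_nonempty
  have hS : 0 < ∑ i, Real.exp ((1 - θ) * a i + θ * b i) :=
    Finset.sum_pos (fun i _ => Real.exp_pos _) univ_nonempty
  set A := ∑ i, Real.exp (a i) with hAdef
  set B := ∑ i, Real.exp (b i) with hBdef
  rw [Real.log_le_iff_le_exp hS]
  have key : ∀ i, Real.exp ((1 - θ) * a i + θ * b i) ≤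
      Real.exp ((1 - θ) * Real.log A + θ * Real.log B) *
        ((1 - θ) * (Real.exp (a i) / A) + θ * (Real.exp (b i) / B)) := by
    intro i
    have h := convexOn_exp.2 (Set.mem_univ (a i - Real.log A)) (Set.mem_univ (b i - Real.log B))
      (sub_nonneg.2 h1) h0 (by ring)
    simp only [smul_eq_mul, Real.exp_sub, Real.exp_log hA, Real.exp_log hB] at h
    calc Real.exp ((1 - θ) * a i + θ * b i)
        = Real.exp ((1 - θ) * Real.log A + θ * Real.log B) *
          Real.exp ((1 - θ) * (a i - Real.log A) + θ * (b i - Real.log B)) := by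
            rw [← Real.exp_add]; ring_nf
      _ ≤ _ := by gcongr
  calc _ ≤ ∑ i, Real.exp ((1 - θ) * Real.log A + θ * Real.log B) *
        ((1 - θ) * (Real.exp (a i) / A) + θ * (Real.exp (b i) / B)) :=
        Finset.sum_le_sum fun i _ => key i
    _ = Real.exp ((1 - θ) * Real.log A + θ * Real.log B) * 1 := by
        rw [← Finset.mul_sum, Finset.sum_add_distrib, ← Finset.mul_sum, ← Finset.mul_sum,
          ← Finset.sum_div, ← Finset.sum_div, ← hAdef, ← hBdef, div_self hA.ne', div_self hB.ne']
        ring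
    _ = _ := mul_one _

lemma sum_cons_bool {d : ℕ} (φ : (Fin (d + 1) → ℝ) → ℝ) :
    ∑ ω : Fin (d + 1) → Bool, φ (fun i => sgn (ω i)) =
      (∑ ω : Fin d → Bool, φ (Fin.cons 1 fun i => sgn (ω i))) +
        ∑ ω : Fin d → Bool, φ (Fin.cons (-1) fun i => sgn (ω i)) := by
  rw [← (Fin.consEquiv (fun _ : Fin (d + 1) => Bool)).sum_comp, Fintype.sum_prod_type,
    Fintype.sum_bool]
  have h : ∀ (b : Bool) (ω : Fin d → Bool),
      (fun i => sgn ((Fin.consEquiv (fun _ : Fin (d + 1) => Bool)) (b, ω) i)) =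
        (Fin.cons (sgn b) fun i => sgn (ω i) : Fin (d + 1) → ℝ) := by
    intro b ω
    ext i
    refine Fin.cases ?_ (fun j => ?_) i <;> simp [Fin.consEquiv]
  simp only [h]
  simp [sgn]

/-- Maurey's property `(τ)` for convex functions on the discrete cube. -/
lemma infConv_exp_mul_exp_neg_le : ∀ {d : ℕ} {f : (Fin d → ℝ) → ℝ},
    ConvexOn ℝ Set.univ f → (∀ x, 0 ≤ f x) →
    (∑ ω : Fin d → Bool, Real.exp (infConv f fun i => sgn (ω i))) *
      (∑ ω : Fin d → Bool, Real.exp (-f fun i => sgn (ω i))) ≤ 4 ^ d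
  | 0, f, _, hf => by
    have h : ∀ x, infConv f x ≤ f x := fun x => by simpa using infConv_le hf x x
    simp only [Fintype.sum_unique, pow_zero, ← Real.exp_add]
    rw [Real.exp_le_one_iff, ← sub_eq_add_neg]
    exact sub_nonpos.2 (h _)
  | d + 1, f, hc, hf => by
    have hslice : ∀ y : ℝ, ConvexOn ℝ Set.univ fun z : Fin d → ℝ => f (Fin.cons y z) := by
      intro y
      refine ⟨convex_univ, fun z₀ _ z₁ _ a b ha hb hab => ?_⟩
      have h := hc.2 (Set.mem_univ (Fin.cons y z₀)) (Set.mem_univ (Fin.cons y z₁)) ha hb hab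
      obtain rfl : a = 1 - b := by linarith
      rw [← cons_convex_comb] at h
      have e : (1 - b) * y + b * y = y := by ring
      rwa [e] at h
    set g : ℝ → ℝ := fun y =>
      Real.log (∑ ω : Fin d → Bool,
        Real.exp (infConv (fun z => f (Fin.cons y z)) fun i => sgn (ω i))) with hg
    have hpos : ∀ φ : (Fin d → Bool) → ℝ, 0 < ∑ ω, Real.exp (φ ω) := fun φ =>
      Finset.sum_pos (fun i _ => Real.exp_pos _) univ_nonempty
    have hgc : ∀ y₀ y₁ θ : ℝ, 0 ≤ θ → θ ≤ 1 →
        g ((1 - θ) * y₀ + θ * y₁) ≤ (1 - θ) * g y₀ + θ * g y₁ := by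
      intro y₀ y₁ θ h0 h1
      refine le_trans (Real.log_le_log (hpos _) (Finset.sum_le_sum fun ω _ =>
        Real.exp_le_exp.2 (infConv_slice_convex hc hf _ y₀ y₁ θ h0 h1)))
        (sum_exp_convex_comb _ _ θ h0 h1)
    have hstep : ∀ s y : ℝ, Real.log (∑ ω : Fin d → Bool,
        Real.exp (infConv f (Fin.cons s fun i => sgn (ω i)))) ≤ g y + (s - y) ^ 2 / 32 := by
      intro s y
      rw [Real.log_le_iff_le_exp (hpos _), Real.exp_add, Real.exp_log (hpos _), Finset.sum_mul]
      refine Finset.sum_le_sum fun ω _ => ?_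
      rw [← Real.exp_add, Real.exp_le_exp, ← sub_le_iff_le_add]
      refine le_ciInf fun z => ?_
      have h := infConv_le hf (Fin.cons s fun i => sgn (ω i)) (Fin.cons y z)
      rw [Fin.sum_univ_succ] at h
      simp only [Fin.cons_zero, Fin.cons_succ] at h
      linarith
    have hup := two_point (a := g 1) (b := g (-1))
      (h₁ := Real.log (∑ ω : Fin d → Bool,
        Real.exp (infConv f (Fin.cons 1 fun i => sgn (ω i)))))
      (h₂ := Real.log (∑ ω : Fin d → Bool,
        Real.exp (infConv f (Fin.cons (-1) fun i => sgn (ω i))))) (fun θ h0 h1 => by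
        have h2 := hstep 1 ((1 - θ) * 1 + θ * (-1))
        have h3 := hgc 1 (-1) θ h0 h1
        have e : (1 - ((1 - θ) * 1 + θ * (-1))) ^ 2 / 32 = θ ^ 2 / 8 := by ring
        rw [e] at h2
        linarith) (fun θ h0 h1 => by
        have h2 := hstep (-1) ((1 - θ) * (-1) + θ * 1)
        have h3 := hgc (-1) 1 θ h0 h1
        have e : (-1 - ((1 - θ) * (-1) + θ * 1)) ^ 2 / 32 = θ ^ 2 / 8 := by ring
        rw [e] at h2
        linarith)
    rw [Real.exp_log (hpos _), Real.exp_log (hpos _)] at hup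
    have hlow : ∀ y : ℝ, ∑ ω : Fin d → Bool, Real.exp (-f (Fin.cons y fun i => sgn (ω i))) ≤
        4 ^ d * Real.exp (-g y) := by
      intro y
      have ih := infConv_exp_mul_exp_neg_le (hslice y) (fun z => hf _)
      rw [Real.exp_neg, hg, Real.exp_log (hpos _), ← div_eq_mul_inv, le_div_iff₀ (hpos _)]
      linarith
    rw [sum_cons_bool (fun x => Real.exp (infConv f x)), sum_cons_bool (fun x => Real.exp (-f x))]
    calc _ ≤ _ * (4 ^ d * Real.exp (-g 1) + 4 ^ d * Real.exp (-g (-1))) :=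
          mul_le_mul_of_nonneg_left (add_le_add (hlow 1) (hlow (-1)))
            (add_pos (hpos _) (hpos _)).le
      _ = 4 ^ d * (_ * (Real.exp (-g 1) + Real.exp (-g (-1)))) := by
          rw [← mul_add, mul_left_comm]
      _ ≤ 4 ^ d * 4 := by gcongr
      _ = 4 ^ (d + 1) := by ring

/-- The Euclidean norm of a finite real vector. -/
noncomputable def l2 {ι : Type*} [Fintype ι] (v : ι → ℝ) : ℝ := Real.sqrt (∑ i, v i ^ 2)

lemma l2_nonneg {ι : Type*} [Fintype ι] (v : ι → ℝ) : 0 ≤ l2 v := Real.sqrt_nonneg _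

lemma l2_sq {ι : Type*} [Fintype ι] (v : ι → ℝ) : l2 v ^ 2 = ∑ i, v i ^ 2 :=
  Real.sq_sqrt (Finset.sum_nonneg fun _ _ => sq_nonneg _)

lemma sum_mul_le_l2_mul_l2 {ι : Type*} [Fintype ι] (v w : ι → ℝ) :
    |∑ i, v i * w i| ≤ l2 v * l2 w := by
  refine abs_le_of_sq_le_sq ?_ (mul_nonneg (l2_nonneg _) (l2_nonneg _))
  rw [mul_pow, l2_sq, l2_sq]
  exact Finset.sum_mul_sq_le_sq_mul_sq _ _ _

lemma concentration_fin {d : ℕ} {F : (Fin d → ℝ) → ℝ} (hc : ConvexOn ℝ Set.univ F)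
    (hF : ∀ x, 0 ≤ F x) {L M t : ℝ} (hL : 0 < L) (ht : 0 ≤ t)
    (hLip : ∀ x y, F x ≤ F y + L * l2 (x - y))
    (hM : ∑ ω : Fin d → Bool, F (fun i => sgn (ω i)) ≤ 2 ^ d * M) :
    (#{ω : Fin d → Bool | M + t ≤ F fun i => sgn (ω i)} : ℝ) ≤
      2 ^ d * Real.exp (-(t ^ 2 / (32 * L ^ 2))) := by
  set lam : ℝ := t / (16 * L ^ 2) with hlam
  have hlam0 : 0 ≤ lam := by positivity
  have htau := infConv_exp_mul_exp_neg_le (f := fun x => lam * F x)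
    (by simpa [Pi.smul_def] using hc.smul hlam0) (fun x => mul_nonneg hlam0 (hF x))
  have hconv : ∀ x, lam * F x - 8 * lam ^ 2 * L ^ 2 ≤ infConv (fun x => lam * F x) x := by
    intro x
    refine le_ciInf fun y => ?_
    have h1 := mul_le_mul_of_nonneg_left (hLip x y) hlam0
    have h2 : ∑ i, (x i - y i) ^ 2 = l2 (x - y) ^ 2 := by rw [l2_sq]; rfl
    rw [h2]
    nlinarith [sq_nonneg (l2 (x - y) - 16 * lam * L)]
  have hjensen : 2 ^ d * Real.exp (-(lam * M)) ≤
      ∑ ω : Fin d → Bool, Real.exp (-(lam * F fun i => sgn (ω i))) := by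
    have h : ∀ ω : Fin d → Bool, Real.exp (-(lam * M)) *
        (1 + lam * M - lam * F fun i => sgn (ω i)) ≤ Real.exp (-(lam * F fun i => sgn (ω i))) := by
      intro ω
      have h1 := Real.add_one_le_exp (lam * M - lam * F fun i => sgn (ω i))
      calc _ ≤ Real.exp (-(lam * M)) * Real.exp (lam * M - lam * F fun i => sgn (ω i)) := by
            gcongr; linarith
        _ = _ := by rw [← Real.exp_add]; ring_nf
    refine le_trans ?_ (Finset.sum_le_sum fun ω _ => h ω)
    rw [← Finset.mul_sum, mul_comm]
    gcongr
    rw [Finset.sum_sub_distrib, ← Finset.mul_sum]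
    simp only [sum_const, card_univ, Fintype.card_fun, Fintype.card_bool, Fintype.card_fin,
      nsmul_eq_mul, Nat.cast_pow, Nat.cast_ofNat]
    nlinarith
  have hmgf : ∑ ω : Fin d → Bool, Real.exp (lam * F fun i => sgn (ω i)) ≤
      2 ^ d * Real.exp (lam * M + 8 * lam ^ 2 * L ^ 2) := by
    have h1 : Real.exp (-(8 * lam ^ 2 * L ^ 2)) *
        ∑ ω : Fin d → Bool, Real.exp (lam * F fun i => sgn (ω i)) ≤
        ∑ ω : Fin d → Bool, Real.exp (infConv (fun x => lam * F x) fun i => sgn (ω i)) := by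
      rw [Finset.mul_sum]
      refine Finset.sum_le_sum fun ω _ => ?_
      rw [← Real.exp_add, Real.exp_le_exp]
      linarith [hconv fun i => sgn (ω i)]
    have h2 := (mul_le_mul h1 hjensen (by positivity)
      (Finset.sum_nonneg fun ω _ => (Real.exp_pos _).le)).trans htau
    have e4 : (4 : ℝ) ^ d = 2 ^ d * 2 ^ d := by rw [← mul_pow]; norm_num
    have e5 : Real.exp (lam * M + 8 * lam ^ 2 * L ^ 2) *
        (Real.exp (-(8 * lam ^ 2 * L ^ 2)) * Real.exp (-(lam * M))) = 1 := by
      rw [← Real.exp_add, ← Real.exp_add]; simp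
    set S := ∑ ω : Fin d → Bool, Real.exp (lam * F fun i => sgn (ω i))
    have h3 : S * (Real.exp (-(8 * lam ^ 2 * L ^ 2)) * Real.exp (-(lam * M))) ≤ 2 ^ d := by
      have h2d : (0 : ℝ) < 2 ^ d := by positivity
      rw [e4] at h2
      refine le_of_mul_le_mul_right ?_ h2d
      linarith
    calc S = Real.exp (lam * M + 8 * lam ^ 2 * L ^ 2) *
          (S * (Real.exp (-(8 * lam ^ 2 * L ^ 2)) * Real.exp (-(lam * M)))) := by
            linear_combination (-S) * e5
      _ ≤ Real.exp (lam * M + 8 * lam ^ 2 * L ^ 2) * 2 ^ d := by gcongr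
      _ = _ := mul_comm _ _
  have hmarkov : (#{ω : Fin d → Bool | M + t ≤ F fun i => sgn (ω i)} : ℝ) *
      Real.exp (lam * (M + t)) ≤ ∑ ω : Fin d → Bool, Real.exp (lam * F fun i => sgn (ω i)) := by
    rw [← nsmul_eq_mul]
    refine (Finset.card_nsmul_le_sum _ _ _ fun ω hω => ?_).trans
      (Finset.sum_le_sum_of_subset_of_nonneg (Finset.filter_subset _ _)
        fun _ _ _ => (Real.exp_pos _).le)
    rw [Real.exp_le_exp]
    exact mul_le_mul_of_nonneg_left (Finset.mem_filter.1 hω).2 hlam0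
  have hexp : Real.exp (lam * M + 8 * lam ^ 2 * L ^ 2) =
      Real.exp (-(t ^ 2 / (32 * L ^ 2))) * Real.exp (lam * (M + t)) := by
    rw [← Real.exp_add]
    congr 1
    rw [hlam]; field_simp; ring
  have := hmarkov.trans hmgf
  rw [hexp, ← mul_assoc] at this
  exact le_of_mul_le_mul_right this (Real.exp_pos _)

/-- Upper deviation inequality for convex Lipschitz functions of independent random signs. -/
lemma concentration {ι : Type*} [Fintype ι] [DecidableEq ι] {F : (ι → ℝ) → ℝ}
    (hc : ConvexOn ℝ Set.univ F)
    (hF : ∀ x, 0 ≤ F x) {L M t : ℝ} (hL : 0 < L) (ht : 0 ≤ t)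
    (hLip : ∀ x y, F x ≤ F y + L * l2 (x - y))
    (hM : ∑ ω : ι → Bool, F (fun i => sgn (ω i)) ≤ 2 ^ Fintype.card ι * M) :
    (#{ω : ι → Bool | M + t ≤ F fun i => sgn (ω i)} : ℝ) ≤
      2 ^ Fintype.card ι * Real.exp (-(t ^ 2 / (32 * L ^ 2))) := by
  set e := Fintype.equivFin ι
  set E : (ι → Bool) ≃ (Fin (Fintype.card ι) → Bool) := Equiv.arrowCongr e (Equiv.refl _)
  have hE : ∀ ω : ι → Bool, (fun i => sgn (E ω (e i))) = fun i => sgn (ω i) := fun ω => by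
    ext i; simp [E]
  have h := concentration_fin (F := fun x => F fun i => x (e i)) (M := M) (t := t)
    ⟨convex_univ, fun x _ y _ a b ha hb hab => hc.2 (Set.mem_univ _) (Set.mem_univ _) ha hb hab⟩
    (fun x => hF _) hL ht (fun x y => ?_) ?_
  · refine le_trans (le_of_eq ?_) h
    congr 1
    refine Finset.card_bij (fun ω _ => E ω) ?_ (fun a _ b _ hab => E.injective hab) ?_
    · intro ω hω
      simpa [hE] using hω
    · intro ω hω
      refine ⟨E.symm ω, ?_, by simp⟩
      have := hE (E.symm ω)
      simp only [Equiv.apply_symm_apply] at this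
      simpa [this] using hω
  · refine (hLip (fun i => x (e i)) (fun i => y (e i))).trans (le_of_eq ?_)
    congr 2
    unfold l2
    congr 1
    exact e.sum_comp fun i => (x i - y i) ^ 2
  · rw [← E.sum_comp]
    simpa [hE] using hM

/-- The signed sum `∑ ε_i v_i`. -/
noncomputable def signSum {ι : Type*} [Fintype ι] (ω : ι → Bool) (v : ι → ℝ) : ℝ :=
  ∑ i, sgn (ω i) * v i

lemma sgn_not (b : Bool) : sgn (!b) = -sgn b := by cases b <;> simp [sgn]

lemma sgn_mul_self (b : Bool) : sgn b * sgn b = 1 := by cases b <;> simp [sgn]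

lemma sum_sgn_mul_sgn {ι : Type*} [Fintype ι] [DecidableEq ι] (i j : ι) :
    ∑ ω : ι → Bool, sgn (ω i) * sgn (ω j) = if i = j then 2 ^ Fintype.card ι else 0 := by
  split_ifs with h
  · subst h
    simp [sgn_mul_self]
  · set τ : Equiv.Perm (ι → Bool) := Function.Involutive.toPerm
      (fun ω => Function.update ω i (!ω i)) (fun ω => by simp)
    have h1 := Equiv.sum_comp τ fun ω : ι → Bool => sgn (ω i) * sgn (ω j)
    have h2 : ∀ ω : ι → Bool, sgn (τ ω i) * sgn (τ ω j) = -(sgn (ω i) * sgn (ω j)) := by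
      intro ω
      simp [τ, Function.Involutive.toPerm, Function.update_of_ne (Ne.symm h), sgn_not]
    simp only [h2, Finset.sum_neg_distrib] at h1
    linarith

lemma sum_sgn_mul_signSum {ι : Type*} [Fintype ι] [DecidableEq ι] (v : ι → ℝ) (j : ι) :
    ∑ ω : ι → Bool, sgn (ω j) * signSum ω v = 2 ^ Fintype.card ι * v j := by
  simp only [signSum, Finset.mul_sum]
  rw [Finset.sum_comm]
  simp only [← mul_assoc, ← Finset.sum_mul, sum_sgn_mul_sgn]
  simp

lemma sum_signSum_sq {ι : Type*} [Fintype ι] [DecidableEq ι] (v : ι → ℝ) :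
    ∑ ω : ι → Bool, signSum ω v ^ 2 = 2 ^ Fintype.card ι * l2 v ^ 2 := by
  have h : ∀ ω : ι → Bool, signSum ω v ^ 2 = ∑ j, v j * (sgn (ω j) * signSum ω v) := by
    intro ω
    rw [sq]
    nth_rewrite 1 [signSum]
    rw [Finset.sum_mul]
    exact Finset.sum_congr rfl fun j _ => by ring
  simp only [h]
  rw [Finset.sum_comm]
  simp only [← Finset.mul_sum, sum_sgn_mul_signSum, l2_sq]
  rw [Finset.mul_sum]
  exact Finset.sum_congr rfl fun j _ => by ring

lemma sum_exp_signSum_le {ι : Type*} [Fintype ι] [DecidableEq ι] (v : ι → ℝ) (s : ℝ) :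
    ∑ ω : ι → Bool, Real.exp (s * signSum ω v) ≤
      2 ^ Fintype.card ι * Real.exp (s ^ 2 * l2 v ^ 2 / 2) := by
  have h : ∑ ω : ι → Bool, Real.exp (s * signSum ω v) =
      ∏ i, ∑ b : Bool, Real.exp (s * (sgn b * v i)) := by
    rw [Finset.prod_univ_sum]
    simp only [Fintype.piFinset_univ]
    refine Finset.sum_congr rfl fun ω _ => ?_
    rw [← Real.exp_sum, signSum, Finset.mul_sum]
  rw [h]
  have h2 : ∀ i, ∑ b : Bool, Real.exp (s * (sgn b * v i)) ≤ 2 * Real.exp (s ^ 2 * v i ^ 2 / 2) := by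
    intro i
    have := Real.cosh_le_exp_half_sq (s * v i)
    rw [Real.cosh_eq, mul_pow] at this
    simp only [Fintype.sum_bool, sgn, if_true, Bool.false_eq_true, if_false, one_mul, neg_mul,
      mul_neg]
    linarith
  refine (Finset.prod_le_prod (fun i _ => Finset.sum_nonneg fun _ _ => (Real.exp_pos _).le)
    fun i _ => h2 i).trans (le_of_eq ?_)
  rw [Finset.prod_mul_distrib, ← Real.exp_sum, l2_sq, Finset.mul_sum, Finset.sum_div]
  simp

/-- Khinchine's inequality, upper bound. -/
lemma khinchine_upper {ι : Type*} [Fintype ι] [DecidableEq ι] (v : ι → ℝ) {q : ℝ} (hq : 2 ≤ q) :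
    ∑ ω : ι → Bool, |signSum ω v| ^ q ≤ 2 ^ Fintype.card ι * (Real.sqrt q * l2 v) ^ q := by
  have hq0 : 0 < q := by linarith
  rcases (l2_nonneg v).eq_or_lt with h0 | hpos
  · have hz : ∀ ω : ι → Bool, signSum ω v = 0 := by
      intro ω
      have := sum_mul_le_l2_mul_l2 (fun i => sgn (ω i)) v
      rw [← h0, mul_zero] at this
      exact abs_nonpos_iff.1 this
    simp only [hz, abs_zero, Real.zero_rpow hq0.ne', Finset.sum_const_zero, ← h0, mul_zero, le_refl]
  set s : ℝ := Real.sqrt q / l2 v with hs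
  have hsq : 0 < Real.sqrt q := Real.sqrt_pos.2 hq0
  have hs0 : 0 < s := by positivity
  have hpt : ∀ x : ℝ, |x| ^ q ≤ (Real.sqrt q * l2 v) ^ q * Real.exp (-q) *
      (Real.exp (s * x) + Real.exp (-s * x)) := by
    intro x
    have h1 : s * |x| / q ≤ Real.exp (s * |x| / q - 1) := by
      linarith [Real.add_one_le_exp (s * |x| / q - 1)]
    have h2 := Real.rpow_le_rpow (by positivity) h1 hq0.le
    rw [← Real.exp_mul] at h2
    have e1 : (s * |x| / q - 1) * q = s * |x| + -q := by field_simp; ring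
    have e2 : |x| = (Real.sqrt q * l2 v) * (s * |x| / q) := by
      rw [hs]; field_simp
      rw [Real.sq_sqrt hq0.le]
    rw [e1, Real.exp_add] at h2
    have h3 : Real.exp (s * |x|) ≤ Real.exp (s * x) + Real.exp (-s * x) := by
      rcases abs_cases x with h | h <;> rw [h.1]
      · linarith [Real.exp_pos (-s * x)]
      · rw [mul_neg, neg_mul]; linarith [Real.exp_pos (s * x)]
    calc |x| ^ q = (Real.sqrt q * l2 v) ^ q * (s * |x| / q) ^ q := by
          rw [← Real.mul_rpow (by positivity) (by positivity), ← e2]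
      _ ≤ (Real.sqrt q * l2 v) ^ q * (Real.exp (s * |x|) * Real.exp (-q)) := by gcongr
      _ ≤ (Real.sqrt q * l2 v) ^ q * ((Real.exp (s * x) + Real.exp (-s * x)) * Real.exp (-q)) := by
          gcongr
      _ = _ := by ring
  have hsv : s ^ 2 * l2 v ^ 2 / 2 = q / 2 := by
    rw [hs, div_pow, Real.sq_sqrt hq0.le]; field_simp
  have hu := sum_exp_signSum_le v s
  have hl := sum_exp_signSum_le v (-s)
  rw [neg_sq] at hl
  rw [hsv] at hu hl
  have h2e : 2 * (Real.exp (-q) * Real.exp (q / 2)) ≤ 1 := by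
    rw [← Real.exp_add]
    have : Real.exp (-q + q / 2) ≤ Real.exp (-1) := Real.exp_le_exp.2 (by linarith)
    have h4 : Real.exp (-1) ≤ 1 / 2 := by
      rw [Real.exp_neg, ← one_div]
      exact one_div_le_one_div_of_le (by norm_num) (by linarith [Real.add_one_le_exp (1 : ℝ)])
    linarith
  calc _ ≤ ∑ ω : ι → Bool, (Real.sqrt q * l2 v) ^ q * Real.exp (-q) *
        (Real.exp (s * signSum ω v) + Real.exp (-s * signSum ω v)) :=
        Finset.sum_le_sum fun ω _ => hpt _
    _ = (Real.sqrt q * l2 v) ^ q * Real.exp (-q) *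
        (∑ ω : ι → Bool, Real.exp (s * signSum ω v) +
          ∑ ω : ι → Bool, Real.exp (-s * signSum ω v)) := by
        rw [← Finset.mul_sum, Finset.sum_add_distrib]
    _ ≤ (Real.sqrt q * l2 v) ^ q * Real.exp (-q) *
        (2 ^ Fintype.card ι * Real.exp (q / 2) + 2 ^ Fintype.card ι * Real.exp (q / 2)) := by gcongr
    _ = 2 ^ Fintype.card ι * (Real.sqrt q * l2 v) ^ q *
        (2 * (Real.exp (-q) * Real.exp (q / 2))) := by ring
    _ ≤ 2 ^ Fintype.card ι * (Real.sqrt q * l2 v) ^ q * 1 := by gcongr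
    _ = _ := mul_one _

/-- Khinchine's inequality, lower bound for the first moment. -/
lemma khinchine_lower {ι : Type*} [Fintype ι] [DecidableEq ι] (v : ι → ℝ) :
    2 ^ Fintype.card ι * (l2 v / 4) ≤ ∑ ω : ι → Bool, |signSum ω v| := by
  rcases (l2_nonneg v).eq_or_lt with h0 | hpos
  · rw [← h0]
    simpa using Finset.sum_nonneg fun (ω : ι → Bool) _ => abs_nonneg (signSum ω v)
  have h4 : ∑ ω : ι → Bool, signSum ω v ^ 4 ≤ 2 ^ Fintype.card ι * (2 * l2 v) ^ 4 := by
    have h := khinchine_upper v (q := 4) (by norm_num)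
    have e : Real.sqrt 4 = 2 := by
      rw [show (4 : ℝ) = 2 ^ 2 by norm_num]; exact Real.sqrt_sq (by norm_num)
    rw [e] at h
    have e2 : ∀ x : ℝ, x ^ (4 : ℝ) = x ^ 4 := fun x => by exact_mod_cast Real.rpow_natCast x 4
    simp only [e2] at h
    have e3 : ∀ x : ℝ, |x| ^ 4 = x ^ 4 := fun x => by
      rw [show 4 = 2 * 2 by rfl, pow_mul, pow_mul, sq_abs]
    simpa only [e3] using h
  have h2 := sum_signSum_sq v
  have hpt : ∀ x : ℝ, 3 / (8 * l2 v) * x ^ 2 - 1 / (128 * l2 v ^ 3) * x ^ 4 ≤ |x| := by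
    intro x
    obtain ⟨y, hy⟩ : ∃ y, |x| = 4 * l2 v * y := ⟨|x| / (4 * l2 v), by field_simp⟩
    have hy0 : 0 ≤ y := by
      by_contra hneg
      have := abs_nonneg x
      nlinarith
    have e2 : x ^ 2 = (4 * l2 v * y) ^ 2 := by rw [← hy, sq_abs]
    have e4 : x ^ 4 = (4 * l2 v * y) ^ 4 := by
      rw [show x ^ 4 = (x ^ 2) ^ 2 by ring, e2]; ring
    rw [hy, e2, e4]
    have e : 3 / (8 * l2 v) * (4 * l2 v * y) ^ 2 - 1 / (128 * l2 v ^ 3) * (4 * l2 v * y) ^ 4 =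
        l2 v * (6 * y ^ 2 - 2 * y ^ 4) := by field_simp; ring
    rw [e]
    have : 0 ≤ y * ((y - 1) ^ 2 * (y + 2)) := by positivity
    nlinarith
  calc 2 ^ Fintype.card ι * (l2 v / 4)
      = 3 / (8 * l2 v) * (2 ^ Fintype.card ι * l2 v ^ 2) -
        1 / (128 * l2 v ^ 3) * (2 ^ Fintype.card ι * (2 * l2 v) ^ 4) := by field_simp; ring
    _ ≤ 3 / (8 * l2 v) * (∑ ω : ι → Bool, signSum ω v ^ 2) -
        1 / (128 * l2 v ^ 3) * ∑ ω : ι → Bool, signSum ω v ^ 4 := by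
        rw [h2]; gcongr
    _ = ∑ ω : ι → Bool, (3 / (8 * l2 v) * signSum ω v ^ 2 -
        1 / (128 * l2 v ^ 3) * signSum ω v ^ 4) := by
        rw [Finset.sum_sub_distrib, Finset.mul_sum, Finset.mul_sum]
    _ ≤ _ := Finset.sum_le_sum fun ω _ => hpt _

/-- The `ℓ_q` norm of a finite family of reals. -/
noncomputable def lqNorm {ι : Type*} [Fintype ι] (q : ℝ) (a : ι → ℝ) : ℝ :=
  (∑ i, |a i| ^ q) ^ (1 / q)

section lqNorm

variable {ι κ : Type*} [Fintype ι] [Fintype κ] {p q r : ℝ}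

lemma sum_abs_rpow_nonneg (a : ι → ℝ) : 0 ≤ ∑ i, |a i| ^ q :=
  Finset.sum_nonneg fun _ _ => by positivity

lemma lqNorm_nonneg (a : ι → ℝ) : 0 ≤ lqNorm q a :=
  Real.rpow_nonneg (sum_abs_rpow_nonneg a) _

lemma lqNorm_rpow (hq : 0 < q) (a : ι → ℝ) : lqNorm q a ^ q = ∑ i, |a i| ^ q := by
  rw [lqNorm, ← Real.rpow_mul (sum_abs_rpow_nonneg a), one_div, inv_mul_cancel₀ hq.ne',
    Real.rpow_one]

lemma lqNorm_mono (hq : 0 < q) {a b : ι → ℝ} (h : ∀ i, |a i| ≤ |b i|) :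
    lqNorm q a ≤ lqNorm q b := by
  refine Real.rpow_le_rpow (sum_abs_rpow_nonneg a) (Finset.sum_le_sum fun i _ => ?_) (by positivity)
  exact Real.rpow_le_rpow (abs_nonneg _) (h i) hq.le

lemma lqNorm_mono_of_nonneg (hq : 0 < q) {a b : ι → ℝ} (ha : ∀ i, 0 ≤ a i) (h : ∀ i, a i ≤ b i) :
    lqNorm q a ≤ lqNorm q b :=
  lqNorm_mono hq fun i => abs_le_abs_of_nonneg (ha i) (h i)

lemma lqNorm_abs (a : ι → ℝ) : (lqNorm q fun i => |a i|) = lqNorm q a := by simp [lqNorm]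

lemma lqNorm_add_le (hq : 1 ≤ q) (a b : ι → ℝ) :
    lqNorm q (fun i => a i + b i) ≤ lqNorm q a + lqNorm q b :=
  Real.Lp_add_le _ _ _ hq

lemma lqNorm_const_mul (hq : 0 < q) (c : ℝ) (a : ι → ℝ) :
    lqNorm q (fun i => c * a i) = |c| * lqNorm q a := by
  unfold lqNorm
  simp_rw [abs_mul, Real.mul_rpow (abs_nonneg _) (abs_nonneg _)]
  rw [← Finset.mul_sum, Real.mul_rpow (by positivity) (sum_abs_rpow_nonneg a),
    ← Real.rpow_mul (abs_nonneg _), one_div, mul_inv_cancel₀ hq.ne', Real.rpow_one]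

lemma lqNorm_zero (hq : 0 < q) : lqNorm q (fun _ : ι => 0) = 0 := by
  simpa using lqNorm_const_mul hq 0 (fun _ : ι => (0 : ℝ))

lemma lqNorm_sum_le (hq : 1 ≤ q) {J : Type*} (s : Finset J) (f : J → ι → ℝ) :
    lqNorm q (fun i => ∑ j ∈ s, f j i) ≤ ∑ j ∈ s, lqNorm q (f j) := by
  classical
  induction s using Finset.induction_on with
  | empty => simp [lqNorm_zero (zero_lt_one.trans_le hq)]
  | insert j s hj ih =>
    simp only [Finset.sum_insert hj]
    exact (lqNorm_add_le hq _ _).trans (by gcongr)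

lemma abs_le_lqNorm (hq : 0 < q) (a : ι → ℝ) (i : ι) : |a i| ≤ lqNorm q a := by
  rw [← Real.rpow_le_rpow_iff (abs_nonneg _) (lqNorm_nonneg _) hq, lqNorm_rpow hq]
  exact Finset.single_le_sum (f := fun i => |a i| ^ q) (fun _ _ => by positivity)
    (Finset.mem_univ i)

/-- The `ℓ_q` norms decrease in `q`. -/
lemma lqNorm_anti (hp : 0 < p) (hpq : p ≤ q) (a : ι → ℝ) : lqNorm q a ≤ lqNorm p a := by
  have hq : 0 < q := hp.trans_le hpq
  rw [← Real.rpow_le_rpow_iff (lqNorm_nonneg _) (lqNorm_nonneg _) hq, lqNorm_rpow hq]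
  calc ∑ i, |a i| ^ q = ∑ i, |a i| ^ (q - p) * |a i| ^ p := by
        refine Finset.sum_congr rfl fun i _ => ?_
        rw [← Real.rpow_add_of_nonneg (abs_nonneg _) (by linarith) hp.le]
        ring_nf
    _ ≤ ∑ i, lqNorm p a ^ (q - p) * |a i| ^ p := by
        gcongr with i
        exact abs_le_lqNorm hp a i
    _ = lqNorm p a ^ q := by
        rw [← Finset.mul_sum, ← lqNorm_rpow hp,
          ← Real.rpow_add_of_nonneg (lqNorm_nonneg _) (by linarith) hp.le]
        ring_nf

lemma lqNorm_one (a : ι → ℝ) : lqNorm 1 a = ∑ i, |a i| := by simp [lqNorm]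

lemma lqNorm_two (a : ι → ℝ) : lqNorm 2 a = l2 a := by
  simp [lqNorm, l2, Real.sqrt_eq_rpow]

lemma lqNorm_le_sum (hq : 1 ≤ q) (a : ι → ℝ) : lqNorm q a ≤ ∑ i, |a i| :=
  lqNorm_one a ▸ lqNorm_anti one_pos hq a

lemma lqNorm_const (hq : 0 < q) (c : ℝ) :
    lqNorm q (fun _ : ι => c) = (Fintype.card ι : ℝ) ^ (1 / q) * |c| := by
  unfold lqNorm
  rw [Finset.sum_const, nsmul_eq_mul, Finset.card_univ, Real.mul_rpow (by positivity)
    (by positivity), ← Real.rpow_mul (abs_nonneg _), mul_one_div_cancel hq.ne', Real.rpow_one]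

/-- Minkowski's inequality for interchanging two `ℓ` norms. -/
lemma lqNorm_lqNorm_le (hp : 0 < p) (hpr : p ≤ r) (f : ι → κ → ℝ) :
    lqNorm r (fun i => lqNorm p (f i)) ≤ lqNorm p (fun j => lqNorm r fun i => f i j) := by
  have hr : 0 < r := hp.trans_le hpr
  have h := lqNorm_sum_le (q := r / p) (by rwa [one_le_div hp]) Finset.univ
    (fun (j : κ) (i : ι) => |f i j| ^ p)
  have e : ∀ x : ℝ, 0 ≤ x → (x ^ p) ^ (r / p) = x ^ r := fun x hx => by
    rw [← Real.rpow_mul hx]; congr 1; field_simp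
  have h1 : lqNorm (r / p) (fun i => ∑ j, |f i j| ^ p) =
      lqNorm r (fun i => lqNorm p (f i)) ^ p := by
    rw [lqNorm, lqNorm, ← Real.rpow_mul (sum_abs_rpow_nonneg _)]
    congr 1
    · refine Finset.sum_congr rfl fun i _ => ?_
      rw [← lqNorm_rpow hp, abs_of_nonneg (Real.rpow_nonneg (lqNorm_nonneg _) _),
        abs_of_nonneg (lqNorm_nonneg _), e _ (lqNorm_nonneg _)]
    · field_simp
  have h2 : ∀ j, lqNorm (r / p) (fun i => |f i j| ^ p) = |lqNorm r fun i => f i j| ^ p := by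
    intro j
    rw [abs_of_nonneg (lqNorm_nonneg _), lqNorm, lqNorm, ← Real.rpow_mul (sum_abs_rpow_nonneg _)]
    congr 1
    · refine Finset.sum_congr rfl fun i _ => ?_
      rw [abs_of_nonneg (Real.rpow_nonneg (abs_nonneg _) _), e _ (abs_nonneg _)]
    · field_simp
  simp only [h1, h2] at h
  rw [← lqNorm_rpow hp] at h
  exact (Real.rpow_le_rpow_iff (lqNorm_nonneg _) (lqNorm_nonneg _) hp).1 h

end lqNorm

section average

variable {ι κ : Type*} [Fintype ι] [Fintype κ] {M : ℕ} {p q : ℝ}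

lemma sqrt_avg_sq_le_lqNorm {Ω : Type*} [Fintype Ω] [Nonempty Ω] (hq : 2 ≤ q) (f : Ω → ℝ)  :
    Real.sqrt ((Fintype.card Ω : ℝ)⁻¹ * ∑ ω, f ω ^ 2) ≤
      ((Fintype.card Ω : ℝ)⁻¹) ^ (1 / q) * lqNorm q f := by
  have hq0 : 0 < q := by linarith
  have hc : (0 : ℝ) < Fintype.card Ω := by exact_mod_cast Fintype.card_pos
  have h := Real.arith_mean_le_rpow_mean Finset.univ (fun _ : Ω => (Fintype.card Ω : ℝ)⁻¹)
    (fun ω => f ω ^ 2) (fun _ _ => by positivity) (by simp [Finset.card_univ, hc.ne'])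
    (fun _ _ => sq_nonneg _) (p := q / 2) (by linarith)
  rw [← Finset.mul_sum, ← Finset.mul_sum] at h
  have e : ∀ ω, (f ω ^ 2) ^ (q / 2) = |f ω| ^ q := fun ω => by
    rw [← sq_abs, ← Real.rpow_natCast, ← Real.rpow_mul (abs_nonneg _)]
    congr 1; push_cast; ring
  simp only [e] at h
  rw [lqNorm, ← Real.mul_rpow (by positivity) (sum_abs_rpow_nonneg _), Real.sqrt_eq_rpow]
  refine (Real.rpow_le_rpow (by positivity) h (by norm_num)).trans (le_of_eq ?_)
  rw [← Real.rpow_mul (mul_nonneg (by positivity) (sum_abs_rpow_nonneg _))]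
  congr 1
  field_simp

lemma avg_le_sqrt_avg_sq {Ω : Type*} [Fintype Ω] [Nonempty Ω] (f : Ω → ℝ) :
    (Fintype.card Ω : ℝ)⁻¹ * ∑ ω, f ω ≤ Real.sqrt ((Fintype.card Ω : ℝ)⁻¹ * ∑ ω, f ω ^ 2) := by
  have hc : (0 : ℝ) < Fintype.card Ω := by exact_mod_cast Fintype.card_pos
  refine Real.le_sqrt_of_sq_le ?_
  have := sq_sum_le_card_mul_sum_sq (s := (Finset.univ : Finset Ω)) (f := f)
  rw [Finset.card_univ] at this
  rw [mul_pow]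
  calc _ ≤ ((Fintype.card Ω : ℝ)⁻¹) ^ 2 * ((Fintype.card Ω : ℝ) * ∑ ω, f ω ^ 2) := by gcongr
    _ = _ := by field_simp

lemma lqNorm_signSum_le [DecidableEq ι] (v : ι → ℝ) (hq : 2 ≤ q) :
    lqNorm q (fun ω : ι → Bool => signSum ω v) ≤
      (Fintype.card (ι → Bool) : ℝ) ^ (1 / q) * (Real.sqrt q * l2 v) := by
  have hq0 : 0 < q := by linarith
  have h0 : 0 ≤ Real.sqrt q * l2 v := mul_nonneg (Real.sqrt_nonneg _) (l2_nonneg _)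
  rw [← abs_of_nonneg h0, ← lqNorm_const hq0]
  rw [← Real.rpow_le_rpow_iff (lqNorm_nonneg _) (lqNorm_nonneg _) hq0, lqNorm_rpow hq0,
    lqNorm_rpow hq0]
  simpa [abs_of_nonneg h0] using khinchine_upper v hq

end average

section mixedNorm

variable {ι κ X : Type*} [Fintype ι] [Fintype κ] [SeminormedAddCommGroup X] [NormedSpace ℝ X]
  {M : ℕ} {p q : ℝ}

lemma map_sign_sum (Φ : X →ₗ[ℝ] ι → κ → ℝ) (x : Fin M → X) (ε : Fin M → Bool) (l : ι) :
    Φ (∑ i, (if ε i then (1:ℝ) else -1) • x i) l = fun r => signSum ε fun i => Φ (x i) l r := by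
  ext r
  simp only [map_sum, map_smul, Finset.sum_apply, Pi.smul_apply, smul_eq_mul, signSum, sgn]

lemma radAvg_eq (x : Fin M → X) :
    radAvg x = (Fintype.card (Fin M → Bool) : ℝ)⁻¹ *
      ∑ ε : Fin M → Bool, ‖∑ i, (if ε i then (1:ℝ) else -1) • x i‖ ^ 2 := by
  simp [radAvg]

/-- Upper Khinchine–Maurey inequality in a subspace of `ℓ_q(ℓ_p)`. -/
lemma sqrt_radAvg_le (hp : 1 ≤ p) (hpq : p ≤ q) (hq : 2 ≤ q) (Φ : X →ₗ[ℝ] ι → κ → ℝ)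
    (hΦ : ∀ x, ‖x‖ = lqNorm q fun l => lqNorm p (Φ x l)) (x : Fin M → X) :
    Real.sqrt (radAvg x) ≤
      Real.sqrt q * lqNorm q fun l => lqNorm p fun r => l2 fun i => Φ (x i) l r := by
  have hq0 : 0 < q := by linarith
  have hp0 : 0 < p := by linarith
  set c : ℝ := (Fintype.card (Fin M → Bool) : ℝ) ^ (1 / q) with hc
  have hc0 : 0 < c := by rw [hc]; positivity
  rw [radAvg_eq]
  refine (sqrt_avg_sq_le_lqNorm hq _).trans ?_
  rw [Real.inv_rpow (by positivity), ← hc, inv_mul_le_iff₀ hc0]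
  simp only [hΦ, map_sign_sum]
  calc _ ≤ lqNorm q fun l => lqNorm q fun ε : Fin M → Bool => lqNorm p fun r =>
          signSum ε fun i => Φ (x i) l r := lqNorm_lqNorm_le hq0 le_rfl _
    _ ≤ lqNorm q fun l => lqNorm p fun r => lqNorm q fun ε : Fin M → Bool =>
          signSum ε fun i => Φ (x i) l r :=
        lqNorm_mono_of_nonneg hq0 (fun _ => lqNorm_nonneg _) fun l => lqNorm_lqNorm_le hp0 hpq _
    _ ≤ lqNorm q fun l => lqNorm p fun r => (c * Real.sqrt q) * l2 fun i => Φ (x i) l r :=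
        lqNorm_mono_of_nonneg hq0 (fun _ => lqNorm_nonneg _) fun l =>
          lqNorm_mono_of_nonneg hp0 (fun _ => lqNorm_nonneg _) fun r => by
            rw [mul_assoc]; exact lqNorm_signSum_le _ hq
    _ = _ := by
        simp only [lqNorm_const_mul hp0, lqNorm_const_mul hq0]
        rw [abs_abs, abs_of_nonneg (by positivity), mul_assoc]

/-- Lower Khinchine–Maurey inequality in a subspace of `ℓ_q(ℓ_p)`. -/
lemma lqNorm_avg_le_sqrt_radAvg (hp : 1 ≤ p) (hq : 1 ≤ q) (Φ : X →ₗ[ℝ] ι → κ → ℝ)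
    (hΦ : ∀ x, ‖x‖ = lqNorm q fun l => lqNorm p (Φ x l)) (x : Fin M → X) {z : ι → κ → ℝ}
    (hz : ∀ l r, 2 ^ M * |z l r| ≤ ∑ ε : Fin M → Bool, |signSum ε fun i => Φ (x i) l r|) :
    (lqNorm q fun l => lqNorm p (z l)) ≤ Real.sqrt (radAvg x) := by
  have hq0 : 0 < q := by linarith
  have hp0 : 0 < p := by linarith
  rw [radAvg_eq]
  refine le_trans ?_ (avg_le_sqrt_avg_sq _)
  simp only [hΦ, map_sign_sum]
  rw [inv_eq_one_div, one_div, ← div_eq_inv_mul, le_div_iff₀ (by positivity), mul_comm]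
  have hcard : (Fintype.card (Fin M → Bool) : ℝ) = |2 ^ M| := by simp
  rw [hcard, ← lqNorm_const_mul hq0]
  calc _ ≤ lqNorm q fun l => ∑ ε : Fin M → Bool, lqNorm p fun r =>
        signSum ε fun i => Φ (x i) l r := by
        refine lqNorm_mono hq0 fun l => ?_
        rw [abs_mul, abs_of_nonneg (lqNorm_nonneg _), ← lqNorm_const_mul hp0]
        refine le_trans ?_ (le_abs_self _)
        calc _ ≤ lqNorm p fun r => ∑ ε : Fin M → Bool, |signSum ε fun i => Φ (x i) l r| := by
              refine lqNorm_mono hp0 fun r => ?_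
              rw [abs_mul, abs_of_pos (by positivity : (0:ℝ) < 2 ^ M)]
              exact (hz l r).trans (le_abs_self _)
          _ ≤ ∑ ε : Fin M → Bool, lqNorm p fun r => |signSum ε fun i => Φ (x i) l r| :=
              lqNorm_sum_le hp _ _
          _ = _ := by simp only [lqNorm_abs]
    _ ≤ _ := lqNorm_sum_le hq _ _

lemma typeConst_le (hp : 1 ≤ p) (hp2 : p ≤ 2) (hq : 2 ≤ q) (Φ : X →ₗ[ℝ] ι → κ → ℝ)
    (hΦ : ∀ x, ‖x‖ = lqNorm q fun l => lqNorm p (Φ x l)) : typeConst p X ≤ Real.sqrt q := by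
  have hq0 : 0 < q := by linarith
  have hp0 : 0 < p := by linarith
  refine csInf_le ⟨0, fun _ h => h.1⟩ ⟨Real.sqrt_nonneg _, fun M x => ?_⟩
  refine (sqrt_radAvg_le hp (hp2.trans hq) hq Φ hΦ x).trans ?_
  gcongr
  have e : (∑ i, ‖x i‖ ^ p) ^ (1 / p) = lqNorm p fun i => ‖x i‖ := by simp [lqNorm]
  rw [e]
  simp only [hΦ]
  calc _ ≤ lqNorm q fun l => lqNorm p fun r => lqNorm p fun i => Φ (x i) l r :=
        lqNorm_mono_of_nonneg hq0 (fun _ => lqNorm_nonneg _) fun l =>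
          lqNorm_mono_of_nonneg hp0 (fun _ => l2_nonneg _) fun r => by
            rw [← lqNorm_two]; exact lqNorm_anti hp0 hp2 _
    _ ≤ lqNorm q fun l => lqNorm p fun i => lqNorm p fun r => Φ (x i) l r :=
        lqNorm_mono_of_nonneg hq0 (fun _ => lqNorm_nonneg _) fun l => lqNorm_lqNorm_le hp0 le_rfl _
    _ ≤ _ := lqNorm_lqNorm_le hp0 (hp2.trans hq) _

lemma cotypeConst_le (hp : 1 ≤ p) (hp2 : p ≤ 2) (hq : 2 ≤ q) (Φ : X →ₗ[ℝ] ι → κ → ℝ)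
    (hΦ : ∀ x, ‖x‖ = lqNorm q fun l => lqNorm p (Φ x l)) : cotypeConst q X ≤ 4 := by
  have hq0 : 0 < q := by linarith
  have hp0 : 0 < p := by linarith
  refine csInf_le ⟨0, fun _ h => h.1⟩ ⟨by norm_num, fun M x => ?_⟩
  have h := lqNorm_avg_le_sqrt_radAvg hp (by linarith) Φ hΦ x
    (z := fun l r => (1 / 4) * l2 fun i => Φ (x i) l r) (fun l r => by
      rw [abs_of_nonneg (mul_nonneg (by norm_num) (l2_nonneg _))]
      have := khinchine_lower fun i => Φ (x i) l r
      rw [Fintype.card_fin] at this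
      convert this using 2; ring)
  simp only [lqNorm_const_mul hp0, lqNorm_const_mul hq0] at h
  rw [abs_abs, abs_of_nonneg (by norm_num : (0:ℝ) ≤ 1 / 4)] at h
  have e : (∑ i, ‖x i‖ ^ q) ^ (1 / q) = lqNorm q fun i => ‖x i‖ := by simp [lqNorm]
  rw [e]
  simp only [hΦ]
  have h2 := calc
    (lqNorm q fun i => lqNorm q fun l => lqNorm p (Φ (x i) l))
      ≤ lqNorm q fun l => lqNorm q fun i => lqNorm p fun r => Φ (x i) l r :=
        lqNorm_lqNorm_le hq0 le_rfl _
    _ ≤ lqNorm q fun l => lqNorm p fun r => lqNorm q fun i => Φ (x i) l r :=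
        lqNorm_mono_of_nonneg hq0 (fun _ => lqNorm_nonneg _) fun l =>
          lqNorm_lqNorm_le hp0 (hp2.trans hq) _
    _ ≤ lqNorm q fun l => lqNorm p fun r => l2 fun i => Φ (x i) l r :=
        lqNorm_mono_of_nonneg hq0 (fun _ => lqNorm_nonneg _) fun l =>
          lqNorm_mono_of_nonneg hp0 (fun _ => lqNorm_nonneg _) fun r => by
            rw [← lqNorm_two]; exact lqNorm_anti two_pos hq _
  linarith

lemma le_typeConst (hp : 1 ≤ p) (hp2 : p ≤ 2) (hq : 2 ≤ q) (Φ : X →ₗ[ℝ] ι → κ → ℝ)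
    (hΦ : ∀ x, ‖x‖ = lqNorm q fun l => lqNorm p (Φ x l)) {p₁ : ℝ} (hp₁ : 1 ≤ p₁) (hp₁2 : p₁ ≤ 2)
    {k : ℕ} (hk : 0 < k) (e : κ ≃ Fin k) (j : ι) (x : Fin k → X) (hx : ∀ i, ‖x i‖ ≤ 2)
    (hx1 : ∀ r, Φ (x (e r)) j r = 1) :
    (1 / 2 : ℝ) * (k : ℝ) ^ (1 / p - 1 / p₁) ≤ typeConst p₁ X := by
  classical
  have hq0 : 0 < q := by linarith
  have hp0 : 0 < p := by linarith
  have hp10 : 0 < p₁ := by linarith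
  have hk0 : (0 : ℝ) < k := by exact_mod_cast hk
  refine le_csInf ⟨Real.sqrt q * (Fintype.card ι * Fintype.card κ), by positivity, fun M x => ?_⟩ ?_
  · refine (sqrt_radAvg_le hp (hp2.trans hq) hq Φ hΦ x).trans ?_
    rw [mul_assoc]
    gcongr
    have e : (∑ i, ‖x i‖ ^ p₁) ^ (1 / p₁) = lqNorm p₁ fun i => ‖x i‖ := by simp [lqNorm]
    rw [e]
    refine (lqNorm_le_sum (by linarith) _).trans ?_
    rw [mul_assoc, ← nsmul_eq_mul, ← nsmul_eq_mul]
    refine Finset.sum_le_card_nsmul _ _ _ fun l _ => ?_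
    rw [abs_of_nonneg (lqNorm_nonneg _)]
    refine (lqNorm_le_sum hp _).trans (Finset.sum_le_card_nsmul _ _ _ fun r _ => ?_)
    rw [abs_of_nonneg (l2_nonneg _), ← lqNorm_two]
    refine (lqNorm_anti hp10 hp₁2 _).trans (lqNorm_mono hp10 fun i => ?_)
    rw [abs_of_nonneg (norm_nonneg _), hΦ]
    calc _ ≤ lqNorm p (Φ (x i) l) := abs_le_lqNorm hp0 _ r
      _ ≤ |lqNorm p (Φ (x i) l)| := le_abs_self _
      _ ≤ _ := abs_le_lqNorm hq0 (fun l => lqNorm p (Φ (x i) l)) l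
  · rintro T ⟨hT, hTx⟩
    have h1 := hTx k x
    have h2 : (∑ i, ‖x i‖ ^ p₁) ^ (1 / p₁) ≤ (k : ℝ) ^ (1 / p₁) * 2 := by
      have e : (∑ i, ‖x i‖ ^ p₁) ^ (1 / p₁) = lqNorm p₁ fun i => ‖x i‖ := by simp [lqNorm]
      rw [e]
      refine (lqNorm_mono_of_nonneg hp10 (fun _ => norm_nonneg _) hx).trans (le_of_eq ?_)
      rw [lqNorm_const hp10]; simp
    have h3 := lqNorm_avg_le_sqrt_radAvg hp (by linarith) Φ hΦ x
      (z := fun l _ => if l = j then 1 else 0) (fun l r => by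
        split_ifs with h
        · subst h
          have h4 := sum_sgn_mul_signSum (fun i => Φ (x i) l r) (e r)
          rw [hx1, Fintype.card_fin] at h4
          rw [abs_one, ← h4]
          refine Finset.sum_le_sum fun ε _ => (le_abs_self _).trans (le_of_eq ?_)
          rw [abs_mul]
          cases ε (e r) <;> simp [sgn]
        · simpa using Finset.sum_nonneg fun _ _ => abs_nonneg _)
    have h5 : (k : ℝ) ^ (1 / p) ≤ Real.sqrt (radAvg x) := by
      refine le_trans ?_ h3
      refine le_trans (le_of_eq ?_) ((le_abs_self _).trans (abs_le_lqNorm hq0 _ j))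
      simp [lqNorm, Fintype.card_congr e]
    have h6 : (k : ℝ) ^ (1 / p) ≤ T * ((k : ℝ) ^ (1 / p₁) * 2) :=
      h5.trans (h1.trans (by gcongr))
    rw [Real.rpow_sub hk0]
    have : 0 < (k : ℝ) ^ (1 / p₁) := by positivity
    rw [← mul_div_assoc, div_le_iff₀ this]
    linarith

end mixedNorm

open Matrix

section l2

variable {ι : Type*} [Fintype ι]

lemma abs_dotProduct_le (v w : ι → ℝ) : |v ⬝ᵥ w| ≤ l2 v * l2 w := sum_mul_le_l2_mul_l2 v w

lemma dotProduct_self_eq_l2_sq (v : ι → ℝ) : v ⬝ᵥ v = l2 v ^ 2 := by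
  rw [l2_sq]; exact Finset.sum_congr rfl fun i _ => (sq (v i)).symm

lemma l2_add_le (v w : ι → ℝ) : l2 (v + w) ≤ l2 v + l2 w := by
  simp only [← lqNorm_two]; exact lqNorm_add_le one_le_two v w

lemma l2_smul (c : ℝ) (v : ι → ℝ) : l2 (c • v) = |c| * l2 v := by
  simp only [← lqNorm_two]; exact lqNorm_const_mul two_pos c v

end l2

/-- The norm `‖(∑_i |⟨G l i, v⟩|)_l‖_q` attached to a block family of vectors. -/
noncomputable def blockNorm {L κ ι : Type*} [Fintype L] [Fintype κ] [Fintype ι] (q : ℝ)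
    (G : L → κ → ι → ℝ) (v : ι → ℝ) : ℝ :=
  lqNorm q fun l => ∑ i, |G l i ⬝ᵥ v|

section blockNorm

variable {L κ ι : Type*} [Fintype L] [Fintype κ] [Fintype ι] {q : ℝ}

lemma blockNorm_nonneg (G : L → κ → ι → ℝ) (v : ι → ℝ) : 0 ≤ blockNorm q G v := lqNorm_nonneg _

lemma blockNorm_smul (hq : 0 < q) (G : L → κ → ι → ℝ) (c : ℝ) (v : ι → ℝ) :
    blockNorm q G (c • v) = |c| * blockNorm q G v := by
  unfold blockNorm
  rw [← abs_abs c, ← lqNorm_const_mul hq]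
  simp only [dotProduct_smul, smul_eq_mul, abs_mul, Finset.mul_sum]

lemma blockNorm_add_le (hq : 1 ≤ q) (G : L → κ → ι → ℝ) (v w : ι → ℝ) :
    blockNorm q G (v + w) ≤ blockNorm q G v + blockNorm q G w := by
  refine le_trans ?_ (lqNorm_add_le hq _ _)
  refine lqNorm_mono_of_nonneg (by linarith) (fun _ => by positivity) fun l => ?_
  rw [← Finset.sum_add_distrib]
  refine Finset.sum_le_sum fun i _ => ?_
  rw [dotProduct_add]
  exact abs_add_le _ _

lemma convexOn_blockNorm (hq : 1 ≤ q) (G : L → κ → ι → ℝ) :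
    ConvexOn ℝ Set.univ (blockNorm q G) := by
  refine ⟨convex_univ, fun v _ w _ a b ha hb _ => ?_⟩
  refine (blockNorm_add_le hq G _ _).trans (le_of_eq ?_)
  simp only [blockNorm_smul (zero_lt_one.trans_le hq), abs_of_nonneg ha, abs_of_nonneg hb,
    smul_eq_mul]

lemma blockNorm_le_sum (hq : 1 ≤ q) (G : L → κ → ι → ℝ) (v : ι → ℝ) :
    blockNorm q G v ≤ ∑ l, ∑ i, |G l i ⬝ᵥ v| := by
  refine (lqNorm_le_sum hq _).trans (Finset.sum_le_sum fun l _ => ?_)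
  rw [abs_of_nonneg (by positivity)]

lemma sum_blockNorm_sgn_le [DecidableEq ι] (hq : 2 ≤ q) (G : L → κ → ι → ℝ) {R : ℝ}
    (hR : ∀ l i, l2 (G l i) ≤ R) (hR0 : 0 ≤ R) :
    ∑ ω : ι → Bool, blockNorm q G (fun a => sgn (ω a)) ≤ 2 ^ Fintype.card ι *
      ((Fintype.card L : ℝ) ^ (1 / q) * Fintype.card κ * Real.sqrt q * R) := by
  have hq0 : 0 < q := by linarith
  set c : ℝ := (Fintype.card (ι → Bool) : ℝ) ^ (1 / q) with hc
  have hc0 : 0 < c := by rw [hc]; positivity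
  have h1 := (avg_le_sqrt_avg_sq fun ω : ι → Bool => blockNorm q G fun a => sgn (ω a)).trans
    (sqrt_avg_sq_le_lqNorm hq _)
  rw [Real.inv_rpow (by positivity), ← hc] at h1
  have h2 : lqNorm q (fun ω : ι → Bool => blockNorm q G fun a => sgn (ω a)) ≤
      (Fintype.card L : ℝ) ^ (1 / q) * (Fintype.card κ * (c * (Real.sqrt q * R))) := by
    calc _ ≤ lqNorm q fun l => lqNorm q fun ω : ι → Bool => ∑ i, |G l i ⬝ᵥ fun a => sgn (ω a)| :=
          lqNorm_lqNorm_le hq0 le_rfl _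
      _ ≤ lqNorm q fun l : L => (Fintype.card κ : ℝ) * (c * (Real.sqrt q * R)) := by
          refine lqNorm_mono_of_nonneg hq0 (fun _ => lqNorm_nonneg _) fun l => ?_
          refine (lqNorm_sum_le (by linarith) Finset.univ
            fun i (ω : ι → Bool) => |G l i ⬝ᵥ fun a => sgn (ω a)|).trans ?_
          rw [← nsmul_eq_mul]
          refine Finset.sum_le_card_nsmul _ _ _ fun i _ => ?_
          rw [lqNorm_abs]
          have := lqNorm_signSum_le (G l i) hq
          simp only [dotProduct_comm (G l i)]
          exact this.trans (by gcongr; exact hR l i)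
      _ = _ := by rw [lqNorm_const hq0, abs_of_nonneg (by positivity)]
  have hcard : (Fintype.card (ι → Bool) : ℝ) = 2 ^ Fintype.card ι := by simp
  rw [hcard, inv_mul_le_iff₀ (by positivity)] at h1
  refine h1.trans (mul_le_mul_of_nonneg_left ?_ (by positivity))
  rw [inv_mul_le_iff₀ hc0]
  refine h2.trans (le_of_eq (by ring))

/-- Concentration of a block norm on the discrete cube. -/
lemma blockNorm_tail [DecidableEq ι] (hq : 2 ≤ q) (G : L → κ → ι → ℝ) {R K t M : ℝ}
    (hR : ∀ l i, l2 (G l i) ≤ R) (hR0 : 0 ≤ R) (hK0 : 0 < K) (ht : 0 ≤ t)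
    (hK : ∀ v, blockNorm q G v ≤ K * l2 v)
    (hM : (Fintype.card L : ℝ) ^ (1 / q) * Fintype.card κ * Real.sqrt q * R ≤ M) :
    (#{ω : ι → Bool | M + t ≤ blockNorm q G fun a => sgn (ω a)} : ℝ) ≤
      2 ^ Fintype.card ι * Real.exp (-(t ^ 2 / (32 * K ^ 2))) := by
  refine concentration (convexOn_blockNorm (by linarith) G) (fun _ => blockNorm_nonneg _ _) hK0 ht
    (fun x y => ?_) ((sum_blockNorm_sgn_le hq G hR hR0).trans (by gcongr))
  have := blockNorm_add_le (q := q) (by linarith) G y (x - y)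
  rw [add_sub_cancel] at this
  linarith [hK (x - y)]

end blockNorm

/-- The block family of sign vectors given by `ω`. -/
noncomputable def signBlock {L κ ι : Type*} (ω : L × κ → ι → Bool) : L → κ → ι → ℝ :=
  fun l i a => sgn (ω (l, i) a)

section goodEvent

variable {L κ ι : Type*} [Fintype L] [Fintype κ] [Fintype ι] {q : ℝ}

lemma blockNorm_signBlock_tail [DecidableEq L] [DecidableEq κ] [DecidableEq ι] (hq : 2 ≤ q)
    [Nonempty κ] {c : ι → ℝ} (hc : l2 c ≤ 2) {t M : ℝ} (ht : 0 ≤ t)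
    (hM : (Fintype.card L : ℝ) ^ (1 / q) * Fintype.card κ * Real.sqrt q * 2 ≤ M) :
    (#{ω : L × κ → ι → Bool | M + t ≤ blockNorm q (signBlock ω) c} : ℝ) ≤
      Fintype.card (L × κ → ι → Bool) * Real.exp (-(t ^ 2 / (128 * Fintype.card κ))) := by
  have hk : (0 : ℝ) < Fintype.card κ := by exact_mod_cast Fintype.card_pos
  set W : L → κ → (L × κ) × ι → ℝ := fun l i z => if (l, i) = z.1 then c z.2 else 0 with hW
  have hdot : ∀ l i x, W l i ⬝ᵥ x = c ⬝ᵥ fun a => x ((l, i), a) := by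
    intro l i x
    simp only [hW, dotProduct, Fintype.sum_prod_type (α₂ := ι), ite_mul, zero_mul]
    rw [Finset.sum_comm]
    simp only [Finset.sum_ite_eq, Finset.mem_univ, if_true]
  have hWR : ∀ l i, l2 (W l i) ≤ 2 := by
    intro l i
    have h := dotProduct_self_eq_l2_sq (W l i)
    rw [hdot] at h
    have e : (fun a => W l i ((l, i), a)) = c := by ext a; simp [hW]
    rw [e, dotProduct_self_eq_l2_sq] at h
    rw [← (pow_left_inj₀ (l2_nonneg _) (l2_nonneg _) two_ne_zero).1 h]
    exact hc
  have hK : ∀ x, blockNorm q W x ≤ (2 * Real.sqrt (Fintype.card κ)) * l2 x := by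
    intro x
    refine (lqNorm_anti two_pos hq _).trans ?_
    rw [lqNorm_two]
    refine abs_le_of_sq_le_sq' ?_ (mul_nonneg (by positivity) (l2_nonneg _)) |>.2
    rw [l2_sq, mul_pow, mul_pow, Real.sq_sqrt hk.le, l2_sq, Fintype.sum_prod_type,
      Fintype.sum_prod_type, Finset.mul_sum]
    refine Finset.sum_le_sum fun l _ => ?_
    refine sq_sum_le_card_mul_sum_sq.trans ?_
    rw [Finset.card_univ, mul_comm _ (Fintype.card κ : ℝ), mul_assoc]
    gcongr
    rw [Finset.mul_sum]
    refine Finset.sum_le_sum fun i _ => ?_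
    rw [hdot, ← l2_sq fun a => x ((l, i), a), ← mul_pow]
    refine pow_le_pow_left₀ (abs_nonneg _) ((abs_dotProduct_le _ _).trans ?_) 2
    exact mul_le_mul_of_nonneg_right hc (l2_nonneg _)
  have h := blockNorm_tail hq W hWR (by norm_num) (by positivity) ht hK hM
  have e1 : (32 * (2 * Real.sqrt (Fintype.card κ)) ^ 2 : ℝ) = 128 * Fintype.card κ := by
    rw [mul_pow, Real.sq_sqrt hk.le]; ring
  rw [e1] at h
  refine le_trans (le_of_eq ?_) (h.trans (le_of_eq ?_))
  · congr 1
    refine (Finset.card_equiv (Equiv.curry (L × κ) ι Bool) fun ω => ?_).symm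
    simp only [Finset.mem_filter, Finset.mem_univ, true_and]
    refine iff_of_eq (congrArg (M + t ≤ lqNorm q ·) ?_)
    ext l
    refine Finset.sum_congr rfl fun i _ => ?_
    rw [hdot, dotProduct_comm]
    rfl
  · simp [Fintype.card_prod, pow_mul']

/-- A `1`-net of the Euclidean ball of radius `2`. -/
lemma exists_net (n : ℕ) : ∃ s : Finset (Fin n → ℝ), s.card ≤ 5 ^ n ∧ (∀ c ∈ s, l2 c ≤ 2) ∧
    ∀ x : Fin n → ℝ, l2 x ≤ 2 → ∃ c ∈ s, l2 (x - c) ≤ 1 := by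
  classical
  let P : Finset (Fin n → ℝ) → Prop := fun s =>
    (∀ c ∈ s, l2 c ≤ 2) ∧ ∀ c ∈ s, ∀ d ∈ s, c ≠ d → 1 ≤ l2 (c - d)
  have hnorm : ∀ v : Fin n → ℝ, ‖(WithLp.toLp 2 v : EuclideanSpace ℝ (Fin n))‖ = l2 v := by
    intro v
    simp [EuclideanSpace.norm_eq, l2]
  have hcard : ∀ s, P s → s.card ≤ 5 ^ n := by
    intro s hs
    have h := Besicovitch.card_le_of_separated
      (s.image fun v => (WithLp.toLp 2 v : EuclideanSpace ℝ (Fin n)))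
      (by
        intro c hc
        obtain ⟨v, hv, rfl⟩ := Finset.mem_image.1 hc
        rw [hnorm]; exact hs.1 v hv)
      (by
        intro c hc d hd hcd
        obtain ⟨v, hv, rfl⟩ := Finset.mem_image.1 hc
        obtain ⟨w, hw, rfl⟩ := Finset.mem_image.1 hd
        rw [← WithLp.toLp_sub, hnorm]
        exact hs.2 v hv w hw fun h => hcd (by rw [h]))
    rwa [Finset.card_image_of_injective _ (WithLp.toLp_injective 2), finrank_euclideanSpace_fin]
      at h
  obtain ⟨N, hN⟩ : ∃ N, N = Nat.findGreatest (fun N => ∃ s, P s ∧ s.card = N) (5 ^ n) := ⟨_, rfl⟩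
  obtain ⟨s, hs, hsN⟩ : ∃ s, P s ∧ s.card = N := by
    rw [hN]
    exact Nat.findGreatest_spec (P := fun N => ∃ s, P s ∧ s.card = N) (Nat.zero_le _)
      ⟨∅, ⟨by simp, by simp⟩, rfl⟩
  refine ⟨s, hcard s hs, hs.1, fun x hx => ?_⟩
  by_contra! hcon
  have hxs : x ∉ s := fun h => by
    have := hcon x h
    rw [sub_self] at this
    simp [l2] at this
    linarith
  have hsymm : ∀ v w : Fin n → ℝ, l2 (v - w) = l2 (w - v) := fun v w => by
    have := l2_smul (-1) (w - v)
    simpa using this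
  have hP : P (insert x s) := by
    refine ⟨?_, ?_⟩
    · simpa using ⟨hx, hs.1⟩
    · intro c hc d hd hcd
      rcases Finset.mem_insert.1 hc with rfl | hc' <;> rcases Finset.mem_insert.1 hd with rfl | hd'
      · exact absurd rfl hcd
      · exact (hcon d hd').le
      · rw [hsymm]; exact (hcon c hc').le
      · exact hs.2 c hc' d hd' hcd
  have h1 := Nat.le_findGreatest (P := fun N => ∃ s, P s ∧ s.card = N) (hcard _ hP) ⟨_, hP, rfl⟩
  rw [Finset.card_insert_of_notMem hxs, ← hN] at h1
  omega

lemma blockNorm_le_of_net {n : ℕ} (hq : 1 ≤ q) (G : L → κ → Fin n → ℝ) {s : Finset (Fin n → ℝ)}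
    (hs : ∀ x : Fin n → ℝ, l2 x ≤ 2 → ∃ c ∈ s, l2 (x - c) ≤ 1) {B : ℝ}
    (hB : ∀ c ∈ s, blockNorm q G c ≤ B) (v : Fin n → ℝ) : blockNorm q G v ≤ B * l2 v := by
  have hq0 : 0 < q := by linarith
  set A : Set ℝ := {K | ∀ v, blockNorm q G v ≤ K * l2 v} with hA
  have hB0 : 0 ≤ B := by
    obtain ⟨c, hc, -⟩ := hs 0 (by simp [l2])
    exact (blockNorm_nonneg _ _).trans (hB c hc)
  have hstep : ∀ K ∈ A, (B + max K 0) / 2 ∈ A := by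
    intro K hK v
    rcases (l2_nonneg v).eq_or_lt with h0 | hpos
    · rw [← h0, mul_zero]
      simpa [← h0] using hK v
    have hl : l2 ((2 / l2 v) • v) = 2 := by
      rw [l2_smul, abs_of_pos (by positivity)]; field_simp
    obtain ⟨c, hc, hxc⟩ := hs ((2 / l2 v) • v) hl.le
    have h1 := blockNorm_add_le hq G c ((2 / l2 v) • v - c)
    rw [add_sub_cancel, blockNorm_smul hq0, abs_of_pos (by positivity)] at h1
    have h2 := hK ((2 / l2 v) • v - c)
    have h3 : K * l2 ((2 / l2 v) • v - c) ≤ max K 0 := by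
      calc _ ≤ max K 0 * l2 ((2 / l2 v) • v - c) :=
            mul_le_mul_of_nonneg_right (le_max_left _ _) (l2_nonneg _)
        _ ≤ max K 0 * 1 := by gcongr
        _ = _ := mul_one _
    have h4 : 2 / l2 v * blockNorm q G v ≤ B + max K 0 := by linarith [hB c hc]
    rw [div_mul_eq_mul_div, div_le_iff₀ hpos] at h4
    linarith
  have hA0 : ∃ K ∈ A, 0 ≤ K := by
    refine ⟨∑ l, ∑ i, l2 (G l i), fun v => (blockNorm_le_sum hq G v).trans ?_,
      Finset.sum_nonneg fun l _ => Finset.sum_nonneg fun i _ => l2_nonneg _⟩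
    rw [Finset.sum_mul]
    refine Finset.sum_le_sum fun l _ => ?_
    rw [Finset.sum_mul]
    exact Finset.sum_le_sum fun i _ => abs_dotProduct_le _ _
  obtain ⟨K, hK, hK0⟩ := hA0
  have hiter : ∀ j : ℕ, B + (1 / 2) ^ j * K ∈ A := by
    intro j
    induction j with
    | zero =>
      intro v
      refine (hK v).trans (mul_le_mul_of_nonneg_right ?_ (l2_nonneg _))
      simpa using hB0
    | succ j ih =>
      have := hstep _ ih
      rw [max_eq_left (by positivity)] at this
      convert this using 1
      rw [pow_succ]; ring
  refine ge_of_tendsto' (f := fun j : ℕ => (B + (1 / 2) ^ j * K) * l2 v) (x := Filter.atTop) ?_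
    fun j => hiter j v
  have := tendsto_pow_atTop_nhds_zero_of_lt_one (r := (1 / 2 : ℝ)) (by norm_num) (by norm_num)
  simpa using ((this.mul_const K).const_add B).mul_const (l2 v)

open Classical in
/-- With probability at least `3/4` a random block family has a small operator norm. -/
lemma card_not_good_le [DecidableEq L] [DecidableEq κ] {n : ℕ} (hn : 1 ≤ n) (hq : 2 ≤ q)
    [Nonempty κ] (hM : (Fintype.card L : ℝ) ^ (1 / q) * Fintype.card κ * Real.sqrt q * 2 ≤
      2 * Real.sqrt (Fintype.card κ * n)) :
    (#{ω : L × κ → Fin n → Bool | ¬ ∀ v, blockNorm q (signBlock ω) v ≤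
      32 * Real.sqrt (Fintype.card κ * n) * l2 v} : ℝ) ≤
      Fintype.card (L × κ → Fin n → Bool) / 4 := by
  have hk : (0 : ℝ) < Fintype.card κ := by exact_mod_cast Fintype.card_pos
  obtain ⟨s, hcard, hs2, hs⟩ := exists_net n
  set S := Real.sqrt (Fintype.card κ * n) with hS
  have hsub : ({ω : L × κ → Fin n → Bool | ¬ ∀ v, blockNorm q (signBlock ω) v ≤
      32 * S * l2 v} : Finset _) ⊆
      s.biUnion fun c => {ω | 2 * S + 30 * S ≤ blockNorm q (signBlock ω) c} := by
    intro ω hω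
    simp only [Finset.mem_filter, Finset.mem_univ, true_and, Finset.mem_biUnion] at hω ⊢
    by_contra! hcon
    exact hω fun v => blockNorm_le_of_net (by linarith) _ hs
      (fun c hc => by linarith [hcon c hc]) v
  have h1 : (30 * S) ^ 2 / (128 * Fintype.card κ) = 900 / 128 * n := by
    rw [mul_pow, hS, Real.sq_sqrt (by positivity)]; field_simp; norm_num
  have h5 : (5 : ℝ) ^ n * Real.exp (-(900 / 128 * n)) ≤ 1 / 4 := by
    have e1 : Real.exp (-(900 / 128 * n)) = Real.exp (-(900 / 128)) ^ n := by
      rw [← Real.exp_nat_mul]; ring_nf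
    have e2 : Real.exp (-(900 / 128 : ℝ)) ≤ 1 / 20 := by
      rw [Real.exp_neg, ← one_div]
      refine one_div_le_one_div_of_le (by norm_num) ?_
      have h3 : (2.7 : ℝ) ≤ Real.exp 1 := by linarith [Real.exp_one_gt_d9]
      calc (20 : ℝ) ≤ 2.7 ^ 7 := by norm_num
        _ ≤ Real.exp 1 ^ 7 := by gcongr
        _ = Real.exp 7 := by rw [← Real.exp_nat_mul]; norm_num
        _ ≤ _ := Real.exp_le_exp.2 (by norm_num)
    rw [e1, ← mul_pow]
    calc (5 * Real.exp (-(900 / 128))) ^ n ≤ (1 / 4) ^ n := by gcongr; linarith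
      _ ≤ (1 / 4) ^ 1 := pow_le_pow_of_le_one (by norm_num) (by norm_num) hn
      _ = _ := pow_one _
  calc _ ≤ ((s.biUnion fun c => {ω : L × κ → Fin n → Bool |
          2 * S + 30 * S ≤ blockNorm q (signBlock ω) c}).card : ℝ) := by
        exact_mod_cast Finset.card_le_card hsub
    _ ≤ ∑ c ∈ s, (#{ω : L × κ → Fin n → Bool | 2 * S + 30 * S ≤ blockNorm q (signBlock ω) c} : ℝ)
        := by exact_mod_cast Finset.card_biUnion_le
    _ ≤ ∑ c ∈ s, Fintype.card (L × κ → Fin n → Bool) * Real.exp (-(900 / 128 * n)) := by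
        refine Finset.sum_le_sum fun c hc => ?_
        rw [← h1]
        exact blockNorm_signBlock_tail hq (hs2 c hc) (by positivity) hM
    _ = Fintype.card (L × κ → Fin n → Bool) * ((s.card : ℝ) * Real.exp (-(900 / 128 * n))) := by
        rw [Finset.sum_const, nsmul_eq_mul]; ring
    _ ≤ Fintype.card (L × κ → Fin n → Bool) * ((5 : ℝ) ^ n * Real.exp (-(900 / 128 * n))) := by
        gcongr; exact_mod_cast hcard
    _ ≤ Fintype.card (L × κ → Fin n → Bool) * (1 / 4) := by gcongr
    _ = _ := by ring

end goodEvent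

lemma sum_sum_update {T Ω : Type*} [Fintype T] [DecidableEq T] [Fintype Ω] (t : T)
    (f : (T → Ω) → ℝ) :
    ∑ ω, ∑ x, f (Function.update ω t x) = Fintype.card Ω * ∑ ω, f ω := by
  let τ : Equiv.Perm ((T → Ω) × Ω) := Function.Involutive.toPerm
    (fun z => (Function.update z.1 t z.2, z.1 t)) (fun z => by simp)
  have h := Equiv.sum_comp τ fun z => f z.1
  rw [Fintype.sum_prod_type, Fintype.sum_prod_type] at h
  refine Eq.trans h ?_
  simp [Finset.mul_sum]

open Classical in
/-- If, conditionally on the earlier coordinates, each event `H t` has probability at most `ρ`,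
then the events indexed by `A` occur simultaneously with probability at most `ρ ^ #A`. -/
lemma card_forall_le_pow {T Ω : Type*} [Fintype T] [DecidableEq T] [Fintype Ω] [Nonempty Ω]
    {rk : T → ℤ} (hrk : Function.Injective rk) {H : T → (T → Ω) → Prop} {ρ : ℝ} (hρ : 0 ≤ ρ)
    (hdep : ∀ t ω ω', (∀ s, rk s ≤ rk t → ω s = ω' s) → H t ω → H t ω')
    (hcard : ∀ t ω, (#{x | H t (Function.update ω t x)} : ℝ) ≤ ρ * Fintype.card Ω)
    (A : Finset T) :
    (#{ω : T → Ω | ∀ t ∈ A, H t ω} : ℝ) ≤ ρ ^ #A * Fintype.card (T → Ω) := by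
  have hΩ : (0 : ℝ) < Fintype.card Ω := by exact_mod_cast Fintype.card_pos
  induction A using Finset.induction_on_max_value rk with
  | empty => simp
  | insert t A ht hmax ih =>
    have hA : ∀ ω x, (∀ s ∈ A, H s (Function.update ω t x)) ↔ ∀ s ∈ A, H s ω := by
      intro ω x
      have hagree : ∀ s ∈ A, ∀ r, rk r ≤ rk s → Function.update ω t x r = ω r := by
        intro s hs r hr
        refine Function.update_of_ne ?_ _ _
        rintro rfl
        exact ht (hrk (le_antisymm (hmax s hs) hr) ▸ hs)
      exact ⟨fun h s hs => hdep s _ _ (hagree s hs) (h s hs),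
        fun h s hs => hdep s _ _ (fun r hr => (hagree s hs r hr).symm) (h s hs)⟩
    have h1 := sum_sum_update t fun ω : T → Ω => if ∀ s ∈ insert t A, H s ω then (1 : ℝ) else 0
    have h2 : ∀ ω : T → Ω, ∑ x, (if ∀ s ∈ insert t A, H s (Function.update ω t x) then (1 : ℝ)
        else 0) ≤ (if ∀ s ∈ A, H s ω then 1 else 0) * (ρ * Fintype.card Ω) := by
      intro ω
      simp only [Finset.forall_mem_insert, hA]
      split_ifs with h
      · rw [one_mul]
        refine le_trans (le_of_eq ?_) (hcard t ω)
        rw [Finset.sum_boole]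
        congr! 3
        exact and_iff_left h
      · simp [h]
    have h3 := Finset.sum_le_sum fun (ω : T → Ω) (_ : ω ∈ Finset.univ) => h2 ω
    rw [h1, ← Finset.sum_mul, Finset.sum_boole, Finset.sum_boole] at h3
    rw [Finset.card_insert_of_notMem ht, pow_succ]
    have h4 : (#{ω : T → Ω | ∀ s ∈ A, H s ω} : ℝ) * (ρ * Fintype.card Ω) ≤
        ρ ^ #A * Fintype.card (T → Ω) * (ρ * Fintype.card Ω) := by gcongr
    refine le_of_mul_le_mul_left (h3.trans (h4.trans (le_of_eq ?_))) hΩ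
    ring

/-- The orthogonal projection onto the span of the rows of `U`, when these are orthonormal. -/
def rowProj {m n : ℕ} (U : Matrix (Fin m) (Fin n) ℝ) (x : Fin n → ℝ) : Fin n → ℝ :=
  Uᵀ *ᵥ (U *ᵥ x)

section rowProj

variable {m n : ℕ} {U : Matrix (Fin m) (Fin n) ℝ}

lemma dotProduct_rowProj (U : Matrix (Fin m) (Fin n) ℝ) (x y : Fin n → ℝ) :
    x ⬝ᵥ rowProj U y = (U *ᵥ x) ⬝ᵥ (U *ᵥ y) := by
  rw [rowProj, dotProduct_mulVec, vecMul_transpose]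

lemma dotProduct_rowProj_comm (U : Matrix (Fin m) (Fin n) ℝ) (x y : Fin n → ℝ) :
    x ⬝ᵥ rowProj U y = rowProj U x ⬝ᵥ y := by
  rw [dotProduct_rowProj, dotProduct_comm _ y, dotProduct_rowProj, dotProduct_comm]

lemma rowProj_add (x y : Fin n → ℝ) : rowProj U (x + y) = rowProj U x + rowProj U y := by
  simp [rowProj, mulVec_add]

lemma rowProj_smul (c : ℝ) (x : Fin n → ℝ) : rowProj U (c • x) = c • rowProj U x := by
  simp [rowProj, mulVec_smul]

lemma l2_rowProj_sq (hU : U * Uᵀ = 1) (x : Fin n → ℝ) :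
    l2 (rowProj U x) ^ 2 = x ⬝ᵥ rowProj U x := by
  have h : U *ᵥ rowProj U x = U *ᵥ x := by
    rw [rowProj, mulVec_mulVec, mulVec_mulVec, hU, Matrix.one_mul]
  rw [← dotProduct_self_eq_l2_sq, dotProduct_rowProj, h, dotProduct_rowProj]

lemma l2_rowProj_le (hU : U * Uᵀ = 1) (x : Fin n → ℝ) : l2 (rowProj U x) ≤ l2 x := by
  have h := (le_abs_self _).trans (abs_dotProduct_le x (rowProj U x))
  rw [← l2_rowProj_sq hU] at h
  rcases (l2_nonneg (rowProj U x)).eq_or_lt with h0 | hpos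
  · rw [← h0]; exact l2_nonneg _
  · nlinarith

lemma l2_sub_rowProj_sq (hU : U * Uᵀ = 1) (x : Fin n → ℝ) :
    l2 (x - rowProj U x) ^ 2 = l2 x ^ 2 - l2 (rowProj U x) ^ 2 := by
  have h := l2_rowProj_sq hU x
  rw [← dotProduct_self_eq_l2_sq (x - _), sub_dotProduct, dotProduct_sub, dotProduct_sub,
    dotProduct_self_eq_l2_sq, dotProduct_self_eq_l2_sq, dotProduct_comm _ x]
  linarith

lemma l2_sub_rowProj_le (hU : U * Uᵀ = 1) (x : Fin n → ℝ) : l2 (x - rowProj U x) ≤ l2 x := by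
  refine abs_le_of_sq_le_sq' ?_ (l2_nonneg _) |>.2
  rw [l2_sub_rowProj_sq hU]
  linarith [sq_nonneg (l2 (rowProj U x))]

lemma l2_sgn_sq (ω : Fin n → Bool) : (l2 fun a => sgn (ω a)) ^ 2 = n := by
  rw [l2_sq]
  simp [sq, sgn_mul_self]

lemma sum_l2_rowProj_sgn_sq (hU : U * Uᵀ = 1) :
    ∑ ω : Fin n → Bool, l2 (rowProj U fun a => sgn (ω a)) ^ 2 = 2 ^ n * m := by
  have h : ∀ ω : Fin n → Bool, l2 (rowProj U fun a => sgn (ω a)) ^ 2 =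
      ∑ c, signSum ω (U c) ^ 2 := by
    intro ω
    rw [l2_rowProj_sq hU, dotProduct_rowProj]
    refine Finset.sum_congr rfl fun c _ => ?_
    rw [sq, mulVec, dotProduct_comm]
    rfl
  simp only [h]
  rw [Finset.sum_comm]
  have h1 : ∀ c, l2 (U c) ^ 2 = 1 := by
    intro c
    have := congrFun (congrFun hU c) c
    rw [← dotProduct_self_eq_l2_sq]
    simpa [Matrix.mul_apply', Matrix.one_apply] using this
  simp [sum_signSum_sq, h1, mul_comm]

/-- The projection of a random sign vector is rarely short. -/
lemma card_rowProj_short_le (hU : U * Uᵀ = 1) (hm : 0 < m) (hmn : m ≤ n) :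
    (#{ω : Fin n → Bool | l2 (rowProj U fun a => sgn (ω a)) ^ 2 < m / 2} : ℝ) ≤
      2 ^ n * Real.exp (-((m : ℝ) ^ 2 / (2 ^ 11 * n))) := by
  have hn0 : (0 : ℝ) < n := by exact_mod_cast hm.trans_le hmn
  have hm0 : (0 : ℝ) < m := by exact_mod_cast hm
  have hmn' : (m : ℝ) ≤ n := by exact_mod_cast hmn
  have hsn : 0 < Real.sqrt n := Real.sqrt_pos.2 hn0
  have hlin : ∀ x y, x + y - rowProj U (x + y) = (x - rowProj U x) + (y - rowProj U y) := by
    intro x y; rw [rowProj_add]; abel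
  have hmul : ∀ (c : ℝ) x, c • x - rowProj U (c • x) = c • (x - rowProj U x) := by
    intro c x; rw [rowProj_smul, smul_sub]
  have h := concentration (ι := Fin n) (F := fun x => l2 (x - rowProj U x)) (L := 1)
    (M := Real.sqrt (n - m)) (t := m / (8 * Real.sqrt n))
    ⟨convex_univ, fun x _ y _ a b ha hb _ => by
      simp only [hlin, hmul]
      refine (l2_add_le _ _).trans (le_of_eq ?_)
      simp [l2_smul, abs_of_nonneg ha, abs_of_nonneg hb]⟩
    (fun _ => l2_nonneg _) one_pos (by positivity)
    (fun x y => by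
      have h1 := hlin y (x - y)
      rw [add_sub_cancel] at h1
      simp only [h1]
      refine (l2_add_le _ _).trans ?_
      rw [one_mul]
      gcongr
      exact l2_sub_rowProj_le hU _)
    (by
      have h1 := avg_le_sqrt_avg_sq fun ω : Fin n → Bool =>
        l2 ((fun a => sgn (ω a)) - rowProj U fun a => sgn (ω a))
      have h2 : ∑ ω : Fin n → Bool, l2 ((fun a => sgn (ω a)) - rowProj U fun a => sgn (ω a)) ^ 2 =
          2 ^ n * (n - m) := by
        simp only [l2_sub_rowProj_sq hU, l2_sgn_sq]
        rw [Finset.sum_sub_distrib, sum_l2_rowProj_sgn_sq hU]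
        simp; ring
      have hcard : (Fintype.card (Fin n → Bool) : ℝ) = 2 ^ n := by simp
      rw [h2, hcard, inv_mul_cancel_left₀ (by positivity), inv_mul_le_iff₀ (by positivity)] at h1
      simpa using h1)
  have e : (m / (8 * Real.sqrt n)) ^ 2 / (32 * 1 ^ 2) = (m : ℝ) ^ 2 / (2 ^ 11 * n) := by
    rw [div_pow, mul_pow, Real.sq_sqrt hn0.le]; field_simp; norm_num
  rw [e, Fintype.card_fin] at h
  refine le_trans (Nat.cast_le.2 (Finset.card_le_card fun ω hω => ?_)) h
  simp only [Finset.mem_filter, Finset.mem_univ, true_and] at hω ⊢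
  refine abs_le_of_sq_le_sq' ?_ (l2_nonneg _) |>.2
  rw [l2_sub_rowProj_sq hU, l2_sgn_sq]
  have h1 : Real.sqrt (n - m) ^ 2 = n - m := Real.sq_sqrt (by linarith)
  have h2 : Real.sqrt (n - m) ≤ Real.sqrt n := Real.sqrt_le_sqrt (by linarith)
  have h3 : Real.sqrt n ^ 2 = n := Real.sq_sqrt hn0.le
  set y : ℝ := m / (8 * Real.sqrt n) with hy
  have hy0 : 0 ≤ y := by positivity
  have h4 : y * Real.sqrt n = m / 8 := by rw [hy]; field_simp
  have h5 : y * Real.sqrt (n - m) ≤ m / 8 := h4 ▸ mul_le_mul_of_nonneg_left h2 hy0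
  have h6 : y ≤ Real.sqrt n := by
    rw [hy, div_le_iff₀ (by positivity)]; nlinarith
  nlinarith [mul_le_mul_of_nonneg_left h6 hy0]

end rowProj

/-- The vectors of the block family `signBlock ω` whose index has rank less than that of `t`, the
remaining ones being replaced by zero. -/
noncomputable def lowBlock {L κ ι : Type*} (rk : L × κ → ℤ) (ω : L × κ → ι → Bool) (t : L × κ) :
    L → κ → ι → ℝ :=
  fun l i a => if rk (l, i) < rk t then sgn (ω (l, i) a) else 0

/-- The event that the projection of the sign vector `ω t` is short or has a large block norm with
respect to the vectors of lower rank, although these have a small operator norm. -/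
def BadEvent {L κ : Type*} [Fintype L] [Fintype κ] {m n : ℕ} (q K : ℝ)
    (U : Matrix (Fin m) (Fin n) ℝ) (rk : L × κ → ℤ) (t : L × κ) (ω : L × κ → Fin n → Bool) : Prop :=
  ((∀ v, blockNorm q (lowBlock rk ω t) v ≤ K * l2 v) ∧
    (m : ℝ) / 32 ≤ blockNorm q (lowBlock rk ω t) (rowProj U fun a => sgn (ω t a))) ∨
  l2 (rowProj U fun a => sgn (ω t a)) ^ 2 < m / 2

section badEvent

variable {L κ : Type*} {m n : ℕ} {q K : ℝ}
  {U : Matrix (Fin m) (Fin n) ℝ} {rk : L × κ → ℤ}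

lemma lowBlock_congr {ι : Type*} {t : L × κ} {ω ω' : L × κ → ι → Bool}
    (h : ∀ s, rk s < rk t → ω s = ω' s) : lowBlock rk ω t = lowBlock rk ω' t := by
  ext l i a
  unfold lowBlock
  split_ifs with h1
  · rw [h _ h1]
  · rfl

lemma BadEvent.congr [Fintype L] [Fintype κ] {t : L × κ} {ω ω' : L × κ → Fin n → Bool}
    (h : ∀ s, rk s ≤ rk t → ω s = ω' s) (hb : BadEvent q K U rk t ω) : BadEvent q K U rk t ω' := by
  unfold BadEvent at hb ⊢
  rwa [← lowBlock_congr fun s hs => h s hs.le, ← h t le_rfl]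

lemma l2_lowBlock_le (ω : L × κ → Fin n → Bool) (t : L × κ) (l : L) (i : κ) :
    l2 (lowBlock rk ω t l i) ≤ Real.sqrt n := by
  refine Real.sqrt_le_sqrt ?_
  refine (Finset.sum_le_card_nsmul _ _ 1 fun a _ => ?_).trans (by simp)
  unfold lowBlock
  split_ifs
  · rw [sq, sgn_mul_self]
  · norm_num

open Classical in
lemma card_badEvent_le [Fintype L] [Fintype κ] [DecidableEq L] [DecidableEq κ] [Nonempty κ]
    (hq : 2 ≤ q) (hU : U * Uᵀ = 1) (hm : 0 < m) (hmn : m ≤ n)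
    (hM : (Fintype.card L : ℝ) ^ (1 / q) * Fintype.card κ * Real.sqrt q * Real.sqrt n ≤ m / 64)
    (t : L × κ) (ω : L × κ → Fin n → Bool) :
    (#{x | BadEvent q (32 * Real.sqrt (Fintype.card κ * n)) U rk t (Function.update ω t x)} : ℝ) ≤
      2 * Real.exp (-((m : ℝ) ^ 2 / (2 ^ 27 * (Fintype.card κ * n)))) *
        Fintype.card (Fin n → Bool) := by
  have hn0 : (0 : ℝ) < n := by exact_mod_cast hm.trans_le hmn
  have hm0 : (0 : ℝ) < m := by exact_mod_cast hm
  have hk : (1 : ℝ) ≤ Fintype.card κ := by exact_mod_cast Fintype.card_pos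
  set K : ℝ := 32 * Real.sqrt (Fintype.card κ * n) with hK
  have hK0 : 0 < K := by positivity
  have hlow : ∀ x, lowBlock rk (Function.update ω t x) t = lowBlock rk ω t := fun x =>
    lowBlock_congr fun s hs => Function.update_of_ne (by rintro rfl; exact lt_irrefl _ hs) _ _
  set E : ℝ := Real.exp (-((m : ℝ) ^ 2 / (2 ^ 27 * (Fintype.card κ * n)))) with hE
  have h1 : (#{x : Fin n → Bool | (∀ v, blockNorm q (lowBlock rk ω t) v ≤ K * l2 v) ∧
      (m : ℝ) / 32 ≤ blockNorm q (lowBlock rk ω t) (rowProj U fun a => sgn (x a))} : ℝ) ≤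
      2 ^ n * E := by
    by_cases hgood : ∀ v, blockNorm q (lowBlock rk ω t) v ≤ K * l2 v
    · have hproj : ∀ v, blockNorm q (fun l i => rowProj U (lowBlock rk ω t l i)) v =
          blockNorm q (lowBlock rk ω t) (rowProj U v) := by
        intro v
        simp only [blockNorm, dotProduct_rowProj_comm]
      have h := blockNorm_tail hq (fun l i => rowProj U (lowBlock rk ω t l i))
        (R := Real.sqrt n) (K := K) (t := m / 64) (M := m / 64)
        (fun l i => (l2_rowProj_le hU _).trans (l2_lowBlock_le ω t l i)) (Real.sqrt_nonneg _) hK0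
        (by positivity) (fun v => by
          rw [hproj]
          exact (hgood _).trans (mul_le_mul_of_nonneg_left (l2_rowProj_le hU v) hK0.le)) hM
      have e : ((m : ℝ) / 64) ^ 2 / (32 * K ^ 2) =
          (m : ℝ) ^ 2 / (2 ^ 27 * (Fintype.card κ * n)) := by
        rw [hK, mul_pow, Real.sq_sqrt (by positivity)]
        field_simp; norm_num
      rw [e, ← hE, Fintype.card_fin] at h
      refine le_trans (Nat.cast_le.2 (Finset.card_le_card fun x hx => ?_)) h
      simp only [Finset.mem_filter, Finset.mem_univ, true_and, hproj] at hx ⊢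
      linarith [hx.2]
    · simp only [hgood, false_and, Finset.filter_false, Finset.card_empty, Nat.cast_zero]
      positivity
  have h2 := card_rowProj_short_le hU hm hmn
  have h3 : Real.exp (-((m : ℝ) ^ 2 / (2 ^ 11 * n))) ≤ E := by
    refine Real.exp_le_exp.2 (neg_le_neg ?_)
    refine div_le_div_of_nonneg_left (by positivity) (by positivity) ?_
    nlinarith
  calc _ ≤ (#(Finset.univ.filter (fun x : Fin n → Bool =>
          (∀ v, blockNorm q (lowBlock rk ω t) v ≤ K * l2 v) ∧
          (m : ℝ) / 32 ≤ blockNorm q (lowBlock rk ω t) (rowProj U fun a => sgn (x a))) ∪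
        Finset.univ.filter fun x : Fin n → Bool =>
          l2 (rowProj U fun a => sgn (x a)) ^ 2 < m / 2) : ℝ) := by
        refine Nat.cast_le.2 (Finset.card_le_card fun x hx => ?_)
        simpa [BadEvent, hlow] using hx
    _ ≤ 2 ^ n * E + 2 ^ n * E := by
        refine (Nat.cast_le.2 (Finset.card_union_le _ _)).trans ?_
        push_cast
        refine add_le_add h1 (h2.trans (by gcongr))
    _ = _ := by simp; ring

end badEvent

section rowNet

variable {m n : ℕ}

lemma abs_entry_le_one {U : Matrix (Fin m) (Fin n) ℝ} (hU : U * Uᵀ = 1) (c : Fin m) (a : Fin n) :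
    |U c a| ≤ 1 := by
  have h : ∑ b, U c b ^ 2 = 1 := by
    have := congrFun (congrFun hU c) c
    simpa [Matrix.mul_apply, Matrix.one_apply, sq] using this
  rw [← sq_le_one_iff_abs_le_one, ← h]
  exact Finset.single_le_sum (f := fun b => U c b ^ 2) (fun _ _ => sq_nonneg _) (Finset.mem_univ a)

/-- An entrywise `1/R`-net of the set of matrices with orthonormal rows. -/
lemma exists_rowNet (m n : ℕ) {R : ℕ} (hR : 0 < R) : ∃ s : Finset (Matrix (Fin m) (Fin n) ℝ),
    #s ≤ (2 * R + 1) ^ (m * n) ∧ (∀ U ∈ s, U * Uᵀ = 1) ∧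
    ∀ U : Matrix (Fin m) (Fin n) ℝ, U * Uᵀ = 1 →
      ∃ U' ∈ s, ∀ c a, |U c a - U' c a| ≤ 1 / (R : ℝ) := by
  classical
  have hR0 : (0 : ℝ) < R := by exact_mod_cast hR
  let cell : Matrix (Fin m) (Fin n) ℝ → Fin m → Fin n → ℤ := fun U c a => ⌊R * U c a⌋
  let P : (Fin m → Fin n → ℤ) → Prop := fun z =>
    ∃ U : Matrix (Fin m) (Fin n) ℝ, U * Uᵀ = 1 ∧ cell U = z
  let rep : (Fin m → Fin n → ℤ) → Matrix (Fin m) (Fin n) ℝ := fun z =>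
    if h : P z then h.choose else 0
  have hrep : ∀ z, P z → rep z * (rep z)ᵀ = 1 ∧ cell (rep z) = z := by
    intro z hz
    simp only [rep, dif_pos hz]
    exact hz.choose_spec
  let cells : Finset (Fin m → Fin n → ℤ) :=
    Fintype.piFinset fun _ => Fintype.piFinset fun _ => Finset.Icc (-(R : ℤ)) R
  refine ⟨(cells.filter P).image rep, ?_, ?_, ?_⟩
  · refine Finset.card_image_le.trans ((Finset.card_filter_le _ _).trans (le_of_eq ?_))
    have e : ((R : ℤ) + 1 + R).toNat = 2 * R + 1 := by omega
    simp [cells, Fintype.card_piFinset, e, pow_mul']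
  · intro U hU
    obtain ⟨z, hz, rfl⟩ := Finset.mem_image.1 hU
    exact (hrep z (Finset.mem_filter.1 hz).2).1
  · intro U hU
    have hP : P (cell U) := ⟨U, hU, rfl⟩
    refine ⟨rep (cell U), Finset.mem_image_of_mem _ (Finset.mem_filter.2 ⟨?_, hP⟩), fun c a => ?_⟩
    · simp only [cells, Fintype.mem_piFinset, Finset.mem_Icc, cell]
      intro c a
      have := abs_le.1 (abs_entry_le_one hU c a)
      constructor
      · rw [Int.le_floor]; push_cast; nlinarith
      · refine Int.floor_le_iff.2 ?_
        push_cast; nlinarith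
    · have h := congrFun (congrFun (hrep _ hP).2 c) a
      simp only [cell] at h
      have h1 := Int.abs_sub_lt_one_of_floor_eq_floor h
      rw [← mul_sub, abs_mul, abs_of_pos hR0] at h1
      rw [abs_sub_comm, le_div_iff₀ hR0]
      linarith

lemma abs_sgn (b : Bool) : |sgn b| = 1 := by cases b <;> simp [sgn]

lemma abs_dotProduct_rowProj_sub_le {U U' : Matrix (Fin m) (Fin n) ℝ} (hU : ∀ c a, |U c a| ≤ 1)
    (hU' : ∀ c a, |U' c a| ≤ 1) {δ : ℝ} (hδ : ∀ c a, |U c a - U' c a| ≤ δ)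
    {x y : Fin n → ℝ} (hx : ∀ a, |x a| ≤ 1) (hy : ∀ a, |y a| ≤ 1) :
    |x ⬝ᵥ rowProj U y - x ⬝ᵥ rowProj U' y| ≤ 2 * m * n ^ 2 * δ := by
  have hbound : ∀ (V : Matrix (Fin m) (Fin n) ℝ) (B : ℝ), (∀ c a, |V c a| ≤ B) →
      ∀ z : Fin n → ℝ, (∀ a, |z a| ≤ 1) → ∀ c, |(V *ᵥ z) c| ≤ n * B := by
    intro V B hV z hz c
    rw [show (V *ᵥ z) c = ∑ a, V c a * z a from rfl]
    refine (Finset.abs_sum_le_sum_abs _ _).trans ?_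
    refine (Finset.sum_le_card_nsmul _ _ B fun a _ => ?_).trans (le_of_eq (by simp))
    rw [abs_mul]
    have hB : 0 ≤ B := (abs_nonneg _).trans (hV c a)
    exact (mul_le_mul (hV c a) (hz a) (abs_nonneg _) hB).trans (mul_one B).le
  rw [dotProduct_rowProj, dotProduct_rowProj]
  have e : (U *ᵥ x) ⬝ᵥ (U *ᵥ y) - (U' *ᵥ x) ⬝ᵥ (U' *ᵥ y) =
      ∑ c, (((U - U') *ᵥ x) c * (U *ᵥ y) c + (U' *ᵥ x) c * ((U - U') *ᵥ y) c) := by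
    simp only [dotProduct, ← Finset.sum_sub_distrib, sub_mulVec, Pi.sub_apply]
    exact Finset.sum_congr rfl fun c _ => by ring
  rw [e]
  refine (Finset.abs_sum_le_sum_abs _ _).trans
      ((Finset.sum_le_card_nsmul _ _ (2 * n ^ 2 * δ) fun c _ => ?_).trans
        (le_of_eq (by simp; ring)))
  have h1 := hbound (U - U') δ hδ x hx c
  have h2 := hbound (U - U') δ hδ y hy c
  have h3 := hbound U 1 hU y hy c
  have h4 := hbound U' 1 hU' x hx c
  have h1' := (abs_nonneg _).trans h1
  refine (abs_add_le _ _).trans ?_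
  rw [abs_mul, abs_mul]
  have h5 := mul_le_mul h1 h3 (abs_nonneg _) h1'
  have h6 := mul_le_mul h4 h2 (abs_nonneg _) (by positivity)
  linarith

end rowNet

/-- The vectors of the block family `signBlock ω` other than the one with index `t`. -/
noncomputable def otherBlock {L κ ι : Type*} [DecidableEq L] [DecidableEq κ]
    (ω : L × κ → ι → Bool) (t : L × κ) : L → κ → ι → ℝ :=
  fun l i a => if (l, i) = t then 0 else sgn (ω (l, i) a)

section randomSigns

variable {L κ : Type*} [Fintype L] [Fintype κ] {m n : ℕ} {q : ℝ}

lemma blockNorm_lowBlock_le (hq : 0 < q) (rk : L × κ → ℤ) (ω : L × κ → Fin n → Bool) (t : L × κ)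
    (v : Fin n → ℝ) : blockNorm q (lowBlock rk ω t) v ≤ blockNorm q (signBlock ω) v := by
  refine lqNorm_mono_of_nonneg hq (fun _ => by positivity) fun l =>
    Finset.sum_le_sum fun i _ => ?_
  by_cases h : rk (l, i) < rk t
  · refine le_of_eq (congrArg (fun w => |w ⬝ᵥ v|) ?_)
    ext a
    simp [lowBlock, signBlock, h]
  · have : lowBlock rk ω t l i = 0 := by
      ext a
      simp [lowBlock, h]
    simp [this]

lemma blockNorm_otherBlock_le [DecidableEq L] [DecidableEq κ] (hq : 1 ≤ q) {rk : L × κ → ℤ}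
    (hrk : Function.Injective rk) (ω : L × κ → Fin n → Bool) (t : L × κ) (v : Fin n → ℝ) :
    blockNorm q (otherBlock ω t) v ≤
      blockNorm q (lowBlock rk ω t) v + blockNorm q (lowBlock (fun s => -rk s) ω t) v := by
  refine le_trans ?_ (lqNorm_add_le hq _ _)
  refine lqNorm_mono_of_nonneg (by linarith) (fun _ => by positivity) fun l => ?_
  rw [← Finset.sum_add_distrib]
  refine Finset.sum_le_sum fun i _ => ?_
  refine le_trans (le_of_eq ?_) (abs_add_le _ _)
  rw [← add_dotProduct]
  congr 2
  ext a
  simp only [otherBlock, lowBlock, Pi.add_apply, neg_lt_neg_iff]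
  rcases lt_trichotomy (rk (l, i)) (rk t) with h | h | h
  · have : (l, i) ≠ t := by rintro rfl; exact lt_irrefl _ h
    simp [h, this, h.le]
  · simp [hrk h]
  · have : (l, i) ≠ t := by rintro rfl; exact lt_irrefl _ h
    simp [h, this, h.le]

open Classical in
lemma card_forall_exists_badEvent_le [DecidableEq L] [DecidableEq κ] [Nonempty κ] (hq : 2 ≤ q)
    {U : Matrix (Fin m) (Fin n) ℝ} (hU : U * Uᵀ = 1) (hm : 0 < m) (hmn : m ≤ n)
    (hM : (Fintype.card L : ℝ) ^ (1 / q) * Fintype.card κ * Real.sqrt q * Real.sqrt n ≤ m / 64)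
    {rk : L × κ → ℤ} (hrk : Function.Injective rk) {d : ℝ} (hd0 : 0 ≤ d)
    (hd : 2 * Real.exp (-((m : ℝ) ^ 2 / (2 ^ 27 * (Fintype.card κ * n)))) ≤ Real.exp (-d)) :
    (#{ω : L × κ → Fin n → Bool | ∀ j, ∃ i,
      BadEvent q (32 * Real.sqrt (Fintype.card κ * n)) U rk (j, i) ω ∨
      BadEvent q (32 * Real.sqrt (Fintype.card κ * n)) U (fun s => -rk s) (j, i) ω} : ℝ) ≤
      (2 * Fintype.card κ) ^ Fintype.card L * Real.exp (-(d * Fintype.card L / 2)) *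
        Fintype.card (L × κ → Fin n → Bool) := by
  set K : ℝ := 32 * Real.sqrt (Fintype.card κ * n)
  let rk' : Bool → L × κ → ℤ := fun b s => if b then rk s else -rk s
  have hrk' : ∀ b, Function.Injective (rk' b) := by
    intro b s s' h
    cases b <;> simp only [rk', Bool.false_eq_true, if_true, if_false, neg_inj] at h <;>
      exact hrk h
  have hfix : ∀ c : L → κ × Bool,
      (#{ω : L × κ → Fin n → Bool | ∀ j, BadEvent q K U (rk' (c j).2) (j, (c j).1) ω} : ℝ) ≤
      Real.exp (-(d * Fintype.card L / 2)) * Fintype.card (L × κ → Fin n → Bool) := by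
    intro c
    obtain ⟨b, hb⟩ : ∃ b, (Fintype.card L : ℝ) / 2 ≤ #{j | (c j).2 = b} := by
      by_contra! hcon
      have h1 := hcon true
      have h2 := hcon false
      have h3 := Finset.card_filter_add_card_filter_not (s := (Finset.univ : Finset L))
        fun j => (c j).2 = true
      simp only [Bool.not_eq_true, Finset.card_univ] at h3
      have h4 : (#{j | (c j).2 = true} : ℝ) + #{j | (c j).2 = false} = Fintype.card L := by
        exact_mod_cast h3
      linarith
    set A : Finset (L × κ) := ({j | (c j).2 = b} : Finset L).image fun j => (j, (c j).1) with hA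
    have hAcard : #A = #{j | (c j).2 = b} :=
      Finset.card_image_of_injective _ fun j j' h => (Prod.ext_iff.1 h).1
    have h := card_forall_le_pow (hrk' b) (H := BadEvent q K U (rk' b)) (Real.exp_pos (-d)).le
      (fun t ω ω' h hb => hb.congr h)
      (fun t ω => (card_badEvent_le hq hU hm hmn hM t ω).trans (by gcongr)) A
    refine le_trans (Nat.cast_le.2 (Finset.card_le_card fun ω hω => ?_)) (h.trans ?_)
    · simp only [Finset.mem_filter, Finset.mem_univ, true_and] at hω ⊢
      intro t ht
      obtain ⟨j, hj, rfl⟩ := Finset.mem_image.1 ht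
      rw [← (Finset.mem_filter.1 hj).2]
      exact hω j
    · rw [← Real.exp_nat_mul, hAcard]
      gcongr
      nlinarith
  calc _ ≤ (#((Finset.univ : Finset (L → κ × Bool)).biUnion fun c =>
        {ω : L × κ → Fin n → Bool | ∀ j, BadEvent q K U (rk' (c j).2) (j, (c j).1) ω}) : ℝ) := by
        refine Nat.cast_le.2 (Finset.card_le_card fun ω hω => ?_)
        simp only [Finset.mem_filter, Finset.mem_univ, true_and, Finset.mem_biUnion] at hω ⊢
        choose i hi using hω
        have : ∀ j, ∃ b, BadEvent q K U (rk' b) (j, i j) ω := fun j =>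
          (hi j).elim (fun h => ⟨true, h⟩) fun h => ⟨false, h⟩
        choose b hb using this
        exact ⟨fun j => (i j, b j), hb⟩
    _ ≤ ∑ c : L → κ × Bool, (#{ω : L × κ → Fin n → Bool |
          ∀ j, BadEvent q K U (rk' (c j).2) (j, (c j).1) ω} : ℝ) := by
        exact_mod_cast Finset.card_biUnion_le
    _ ≤ ∑ c : L → κ × Bool, Real.exp (-(d * Fintype.card L / 2)) *
          Fintype.card (L × κ → Fin n → Bool) := Finset.sum_le_sum fun c _ => hfix c
    _ = _ := by
        rw [Finset.sum_const, Finset.card_univ, nsmul_eq_mul, Fintype.card_fun, Fintype.card_prod,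
          Fintype.card_bool]
        push_cast
        ring

/-- There is a block family of sign vectors such that every orthogonal projection of rank `m`
nearly preserves all the vectors of some block and makes them nearly orthogonal to the
other vectors of the family. -/
lemma exists_signs {N k R : ℕ} (hq : 2 ≤ q) (hm : 0 < m) (hmn : m ≤ n) (hN : 0 < N) (hk : 0 < k)
    (hR : 0 < R) (hM : (N : ℝ) ^ (1 / q) * k * Real.sqrt q * Real.sqrt n ≤ m / 64)
    (hRm : (N * k : ℝ) * (2 * n ^ 2) / R ≤ 1 / 16) {d : ℝ} (hd0 : 0 ≤ d)
    (hd : 2 * Real.exp (-((m : ℝ) ^ 2 / (2 ^ 27 * (k * n)))) ≤ Real.exp (-d))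
    (hnum : (2 * R + 1 : ℝ) ^ (m * n) * ((2 * k) ^ N * Real.exp (-(d * N / 2))) ≤ 1 / 2) :
    ∃ ω : Fin N × Fin k → Fin n → Bool, ∀ U : Matrix (Fin m) (Fin n) ℝ, U * Uᵀ = 1 →
      ∃ j, ∀ i, (m : ℝ) / 4 ≤ signBlock ω j i ⬝ᵥ rowProj U (signBlock ω j i) ∧
        blockNorm q (otherBlock ω (j, i)) (rowProj U (signBlock ω j i)) ≤ m / 8 := by
  classical
  have : Nonempty (Fin k) := ⟨⟨0, hk⟩⟩
  have hm0 : (0 : ℝ) < m := by exact_mod_cast hm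
  have hmn' : (m : ℝ) ≤ n := by exact_mod_cast hmn
  have hn0 : (0 : ℝ) < n := hm0.trans_le hmn'
  have hR0 : (0 : ℝ) < R := by exact_mod_cast hR
  have hk1 : (1 : ℝ) ≤ k := by exact_mod_cast hk
  have hN1 : (1 : ℝ) ≤ N := by exact_mod_cast hN
  obtain ⟨net, hcard, hnetU, hnet⟩ := exists_rowNet m n hR
  let rk : Fin N × Fin k → ℤ := fun s => (finProdFinEquiv s : ℕ)
  have hrk : Function.Injective rk := by
    intro s s' h
    simp only [rk, Nat.cast_inj] at h
    exact finProdFinEquiv.injective (Fin.ext h)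
  set K : ℝ := 32 * Real.sqrt (k * n) with hK
  have hgood := card_not_good_le (L := Fin N) (κ := Fin k) (q := q) (n := n)
    (hm.trans_le hmn) hq (by
      simp only [Fintype.card_fin]
      have h1 : 0 < Real.sqrt n := Real.sqrt_pos.2 hn0
      have h2 : Real.sqrt n * Real.sqrt n = n := Real.mul_self_sqrt hn0.le
      have h3 : (N : ℝ) ^ (1 / q) * k * Real.sqrt q ≤ Real.sqrt n := by
        refine le_of_mul_le_mul_right ?_ h1
        linarith
      have h4 : Real.sqrt n ≤ Real.sqrt (k * n) := Real.sqrt_le_sqrt (by nlinarith)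
      linarith)
  simp only [Fintype.card_fin, ← hK] at hgood
  set Ω : ℝ := ((Fintype.card (Fin N × Fin k → Fin n → Bool) : ℕ) : ℝ) with hΩ
  have hΩ0 : 0 < Ω := by rw [hΩ]; exact_mod_cast Fintype.card_pos
  let bad : Matrix (Fin m) (Fin n) ℝ → Finset (Fin N × Fin k → Fin n → Bool) := fun U =>
    {ω | ∀ j, ∃ i, BadEvent q K U rk (j, i) ω ∨ BadEvent q K U (fun s => -rk s) (j, i) ω}
  have hbad : ∀ U ∈ net, (#(bad U) : ℝ) ≤ (2 * k) ^ N * Real.exp (-(d * N / 2)) * Ω := by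
    intro U hU
    have := card_forall_exists_badEvent_le (L := Fin N) (κ := Fin k) hq (hnetU U hU) hm hmn
      (by simpa using hM) hrk hd0 (by simpa using hd)
    simpa only [Fintype.card_fin] using this
  have hsum : (#(net.biUnion bad) : ℝ) ≤ Ω / 2 := by
    calc (#(net.biUnion bad) : ℝ) ≤ ∑ U ∈ net, (#(bad U) : ℝ) := by
          exact_mod_cast Finset.card_biUnion_le
      _ ≤ ∑ U ∈ net, (2 * k) ^ N * Real.exp (-(d * N / 2)) * Ω := Finset.sum_le_sum hbad
      _ = #net * ((2 * k) ^ N * Real.exp (-(d * N / 2))) * Ω := by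
          rw [Finset.sum_const, nsmul_eq_mul]; ring
      _ ≤ (2 * R + 1) ^ (m * n) * ((2 * k) ^ N * Real.exp (-(d * N / 2))) * Ω := by
          gcongr
          exact_mod_cast hcard
      _ ≤ 1 / 2 * Ω := by gcongr
      _ = _ := by ring
  obtain ⟨ω, hω⟩ : ∃ ω, ω ∉ net.biUnion bad ∪
      Finset.univ.filter fun ω : Fin N × Fin k → Fin n → Bool =>
      ¬ ∀ v, blockNorm q (signBlock ω) v ≤ K * l2 v := by
    by_contra hcon
    simp only [not_exists, not_not] at hcon
    have h2 := (Finset.card_le_card (s := Finset.univ) fun ω _ => hcon ω).trans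
      (Finset.card_union_le _ _)
    rw [Finset.card_univ] at h2
    have h3 : Ω ≤ (#(net.biUnion bad) : ℝ) + #{ω : Fin N × Fin k → Fin n → Bool |
        ¬ ∀ v, blockNorm q (signBlock ω) v ≤ K * l2 v} := by
      rw [hΩ, ← Nat.cast_add]
      exact Nat.cast_le.2 h2
    linarith
  simp only [Finset.mem_union, not_or, Finset.mem_biUnion, not_exists, not_and, Finset.mem_filter,
    Finset.mem_univ, true_and, not_not, bad] at hω
  refine ⟨ω, fun U hU => ?_⟩
  obtain ⟨U', hU's, hUU'⟩ := hnet U hU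
  have hj := hω.1 U' hU's
  push Not at hj
  obtain ⟨j, hj⟩ := hj
  refine ⟨j, fun i => ?_⟩
  have hclose : ∀ x : Fin n → ℝ, (∀ a, |x a| ≤ 1) →
      |x ⬝ᵥ rowProj U (signBlock ω j i) - x ⬝ᵥ rowProj U' (signBlock ω j i)| ≤
        2 * m * n ^ 2 * (1 / R) := fun x hx =>
    abs_dotProduct_rowProj_sub_le (abs_entry_le_one hU) (abs_entry_le_one (hnetU U' hU's)) hUU' hx
      fun a => (abs_sgn _).le
  have herr : (N * k : ℝ) * (2 * m * n ^ 2 * (1 / R)) ≤ m / 16 := by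
    have := mul_le_mul_of_nonneg_left hRm hm0.le
    calc _ = m * ((N * k : ℝ) * (2 * n ^ 2) / R) := by ring
      _ ≤ m * (1 / 16) := this
      _ = _ := by ring
  have hlow : ∀ r : Fin N × Fin k → ℤ, ¬ BadEvent q K U' r (j, i) ω →
      blockNorm q (lowBlock r ω (j, i)) (rowProj U' (signBlock ω j i)) ≤ m / 32 := by
    intro r hr
    by_contra! hcon
    exact hr (Or.inl ⟨fun v => (blockNorm_lowBlock_le (by linarith) r ω _ v).trans (hω.2 v),
      hcon.le⟩)
  constructor
  · have h1 : (m : ℝ) / 2 ≤ l2 (rowProj U' (signBlock ω j i)) ^ 2 := by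
      by_contra! hcon
      exact (hj i).1 (Or.inr hcon)
    rw [l2_rowProj_sq (hnetU U' hU's)] at h1
    have h2 := abs_le.1 (hclose (signBlock ω j i) fun a => (abs_sgn _).le)
    have h3 : 2 * m * n ^ 2 * (1 / R) ≤ (N * k : ℝ) * (2 * m * n ^ 2 * (1 / R)) :=
      le_mul_of_one_le_left (by positivity) (by nlinarith)
    linarith [h2.1]
  · have h1 := blockNorm_otherBlock_le (q := q) (by linarith) hrk ω (j, i)
      (rowProj U' (signBlock ω j i))
    have h2 := hlow rk (hj i).1
    have h3 := hlow (fun s => -rk s) (hj i).2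
    have h4 := blockNorm_add_le (q := q) (by linarith) (otherBlock ω (j, i))
      (rowProj U' (signBlock ω j i))
      (rowProj U (signBlock ω j i) - rowProj U' (signBlock ω j i))
    rw [add_sub_cancel] at h4
    have h5 : blockNorm q (otherBlock ω (j, i))
        (rowProj U (signBlock ω j i) - rowProj U' (signBlock ω j i)) ≤
        (N * k : ℝ) * (2 * m * n ^ 2 * (1 / R)) := by
      refine (blockNorm_le_sum (by linarith) _ _).trans ?_
      rw [← Fintype.sum_prod_type']
      refine (Finset.sum_le_card_nsmul _ _ (2 * m * n ^ 2 * (1 / R) : ℝ) fun s _ => ?_).trans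
        (le_of_eq (by simp))
      rw [dotProduct_sub]
      refine hclose _ fun a => ?_
      unfold otherBlock
      split_ifs
      · simp
      · exact (abs_sgn _).le
    linarith

end randomSigns

section parameters

variable {q : ℝ} {n m k : ℕ}

lemma two_le_and_mul_rpow_le (hq : 2 < q) (hn : 0 < n) (hk : 0 < k)
    (h : (k : ℝ) ≤ 2⁻¹ ^ 37 * (m : ℝ) / (Real.sqrt q * (n : ℝ) ^ (1 - (q - 2) / (2 * q + 2)) *
        (Real.log n) ^ ((1 - 2 * ((q - 2) / (2 * q + 2))) / 3))) :
    2 ≤ n ∧ k * Real.sqrt q * Real.sqrt n * (n * Real.sqrt n * Real.log n) ^ (1 / (q + 1)) ≤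
      2⁻¹ ^ 37 * m := by
  have hk0 : (0 : ℝ) < k := by exact_mod_cast hk
  have hn0 : (0 : ℝ) < n := by exact_mod_cast hn
  have hq1 : q + 1 ≠ 0 := by linarith
  have hq2 : 2 * q + 2 ≠ 0 := by linarith
  have es : (1 - 2 * ((q - 2) / (2 * q + 2))) / 3 = 1 / (q + 1) := by field_simp; ring
  have ee : 1 - (q - 2) / (2 * q + 2) = 1 / 2 + 1 / (q + 1) + 1 / 2 * (1 / (q + 1)) := by
    field_simp; ring
  rw [es, ee] at h
  have hlog : 0 ≤ Real.log n := Real.log_natCast_nonneg n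
  have h2 : 2 ≤ n := by
    by_contra hlt
    obtain rfl : n = 1 := by omega
    have : (1 / (q + 1)) ≠ 0 := one_div_ne_zero hq1
    rw [Nat.cast_one, Real.log_one, Real.zero_rpow this, mul_zero, div_zero] at h
    linarith
  refine ⟨h2, ?_⟩
  have hlog0 : 0 < Real.log n := Real.log_pos (by exact_mod_cast h2)
  have hq0 : 0 < Real.sqrt q := Real.sqrt_pos.2 (by linarith)
  rw [le_div_iff₀ (by positivity)] at h
  refine le_trans (le_of_eq ?_) h
  rw [Real.mul_rpow (by positivity) hlog, Real.mul_rpow hn0.le (by positivity),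
    Real.rpow_add hn0, Real.rpow_add hn0, Real.rpow_mul hn0.le, ← Real.sqrt_eq_rpow]
  ring

set_option maxHeartbeats 1000000 in
lemma exists_parameters (hq : 2 < q) (hn : 0 < n) (hm : 0 < m) (hk : 0 < k) (hmn : m ≤ n)
    (h : (k : ℝ) ≤ 2⁻¹ ^ 37 * (m : ℝ) / (Real.sqrt q * (n : ℝ) ^ (1 - (q - 2) / (2 * q + 2)) *
        (Real.log n) ^ ((1 - 2 * ((q - 2) / (2 * q + 2))) / 3))) :
    ∃ (N R : ℕ) (d : ℝ), 0 < N ∧ 0 < R ∧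
      (N : ℝ) ^ (1 / q) * k * Real.sqrt q * Real.sqrt n ≤ m / 64 ∧
      (N * k : ℝ) * (2 * n ^ 2) / R ≤ 1 / 16 ∧ 0 ≤ d ∧
      2 * Real.exp (-((m : ℝ) ^ 2 / (2 ^ 27 * (k * n)))) ≤ Real.exp (-d) ∧
      (2 * R + 1 : ℝ) ^ (m * n) * ((2 * k) ^ N * Real.exp (-(d * N / 2))) ≤ 1 / 2 := by
  obtain ⟨hn2, hmain⟩ := two_le_and_mul_rpow_le hq hn hk h
  have hk1 : (1 : ℝ) ≤ k := by exact_mod_cast hk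
  have hm1 : (1 : ℝ) ≤ m := by exact_mod_cast hm
  have hn2' : (2 : ℝ) ≤ n := by exact_mod_cast hn2
  have hmn' : (m : ℝ) ≤ n := by exact_mod_cast hmn
  have hn0 : (0 : ℝ) < n := by linarith
  have hm0 : (0 : ℝ) < m := by linarith
  have hk0 : (0 : ℝ) < k := by linarith
  have hq0 : 0 < q := by linarith
  set L := Real.log n with hL
  have hL1 : 1 / 2 ≤ L := by
    have := Real.log_le_log (by norm_num) hn2'
    linarith [Real.log_two_gt_d9]
  have hLn : L ≤ n := (Real.log_le_sub_one_of_pos hn0).trans (by linarith)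
  have hsn : Real.sqrt n * Real.sqrt n = n := Real.mul_self_sqrt hn0.le
  have hsq : Real.sqrt q * Real.sqrt q = q := Real.mul_self_sqrt hq0.le
  have hsn1 : 1 ≤ Real.sqrt n := Real.one_le_sqrt.2 (by linarith)
  have hsq1 : 1 ≤ Real.sqrt q := Real.one_le_sqrt.2 (by linarith)
  set T := k * Real.sqrt q * Real.sqrt n with hT
  set X := n * Real.sqrt n * L with hX
  have hT0 : 0 < T := by positivity
  have hX1 : 1 ≤ X := by
    have : (1 : ℝ) ≤ n * L := by nlinarith
    calc (1 : ℝ) ≤ (n * L) * Real.sqrt n := one_le_mul_of_one_le_of_one_le this hsn1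
      _ = X := by ring
  have hTm : T ≤ 2⁻¹ ^ 37 * m :=
    (le_mul_of_one_le_right hT0.le (Real.one_le_rpow hX1 (by positivity))).trans hmain
  have hkT : (k : ℝ) ≤ T := by
    calc (k : ℝ) ≤ k * (Real.sqrt q * Real.sqrt n) :=
          le_mul_of_one_le_right hk0.le (one_le_mul_of_one_le_of_one_le hsq1 hsn1)
      _ = T := by ring
  have hkn : (k : ℝ) ≤ n := by linarith
  have hpow : T ^ q * T * X ≤ (2⁻¹ ^ 37 * m) ^ q * (2⁻¹ ^ 37 * m) := by
    have h1 := Real.rpow_le_rpow (by positivity) hmain (by linarith : 0 ≤ q + 1)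
    rw [Real.mul_rpow hT0.le (by positivity), ← Real.rpow_mul (by positivity),
      one_div_mul_cancel (by linarith), Real.rpow_one, Real.rpow_add hT0,
      Real.rpow_add (by positivity), Real.rpow_one, Real.rpow_one] at h1
    exact h1
  set N0 : ℝ := 2 ^ 36 * (n ^ 2 * k * L / m) with hN0
  have hN0m : N0 * m = 2 ^ 36 * (n ^ 2 * k * L) := by rw [hN0]; field_simp
  have hN01 : 1 ≤ N0 := by
    refine le_of_mul_le_mul_right ?_ hm0
    rw [hN0m, one_mul]
    have h1 : (1 : ℝ) ≤ k * (n * L) := one_le_mul_of_one_le_of_one_le hk1 (by nlinarith)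
    nlinarith
  set N := ⌈N0⌉₊ with hN
  have hNlow : N0 ≤ N := Nat.le_ceil _
  have hNup : N ≤ 2 * N0 := (Nat.ceil_lt_add_one (by linarith)).le.trans (by linarith)
  have hNpos : (0 : ℝ) < N := by linarith
  set D : ℝ := m ^ 2 / (k * n) with hD
  have hDm : D * (k * n) = m ^ 2 := by rw [hD]; field_simp
  have hDk : 2 ^ 74 * k ≤ D := by
    rw [hD, le_div_iff₀ (by positivity)]
    have h1 : T ^ 2 = k ^ 2 * q * n := by
      calc T ^ 2 = k ^ 2 * (Real.sqrt q * Real.sqrt q) * (Real.sqrt n * Real.sqrt n) := by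
            rw [hT]; ring
        _ = _ := by rw [hsn, hsq]
    have h2 : T ^ 2 ≤ (2⁻¹ ^ 37 * m) ^ 2 := by gcongr
    have h3 : (k : ℝ) ^ 2 * n ≤ k ^ 2 * q * n := by
      have : (0 : ℝ) ≤ k ^ 2 * n := by positivity
      nlinarith
    have h4 : (2⁻¹ ^ 37 * m : ℝ) ^ 2 = m ^ 2 / 2 ^ 74 := by ring
    rw [h4] at h2
    have h5 : (k : ℝ) ^ 2 * n ≤ m ^ 2 / 2 ^ 74 := by linarith
    rw [le_div_iff₀ (by positivity)] at h5
    linarith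
  have hlog2 := Real.log_two_lt_d9
  refine ⟨N, n ^ 60, D / 2 ^ 27 - Real.log 2, by exact_mod_cast hNpos, by positivity, ?_, ?_, ?_,
    ?_, ?_⟩
  · have e : (N : ℝ) ^ (1 / q) * k * Real.sqrt q * Real.sqrt n = (N : ℝ) ^ (1 / q) * T := by
      rw [hT]; ring
    rw [e]
    rw [← Real.rpow_le_rpow_iff (by positivity) (by positivity) hq0,
      Real.mul_rpow (by positivity) hT0.le, ← Real.rpow_mul hNpos.le, one_div_mul_cancel hq0.ne',
      Real.rpow_one]
    have hXT : n ^ 2 * k * L ≤ T * X := by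
      calc n ^ 2 * k * L ≤ (n ^ 2 * k * L) * Real.sqrt q :=
            le_mul_of_one_le_right (by positivity) hsq1
        _ = k * Real.sqrt q * (Real.sqrt n * Real.sqrt n) * n * L := by rw [hsn]; ring
        _ = T * X := by rw [hT, hX]; ring
    have hTq : 0 < T ^ q := by positivity
    calc (N : ℝ) * T ^ q ≤ 2 * N0 * T ^ q := by gcongr
      _ = 2 ^ 37 * (n ^ 2 * k * L * T ^ q) / m := by rw [hN0]; ring
      _ ≤ 2 ^ 37 * (T * X * T ^ q) / m := by gcongr
      _ = 2 ^ 37 * (T ^ q * T * X) / m := by ring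
      _ ≤ 2 ^ 37 * ((2⁻¹ ^ 37 * m) ^ q * (2⁻¹ ^ 37 * m)) / m := by gcongr
      _ = (2⁻¹ ^ 37 * m : ℝ) ^ q := by field_simp
      _ ≤ (m / 64 : ℝ) ^ q := by
          refine Real.rpow_le_rpow (by positivity) ?_ hq0.le
          linarith
  · rw [div_le_iff₀ (by positivity)]
    have h1 : N0 ≤ 2 ^ 36 * n ^ 4 := by
      refine le_of_mul_le_mul_right ?_ hm0
      rw [hN0m]
      calc (2 : ℝ) ^ 36 * (n ^ 2 * k * L) ≤ 2 ^ 36 * ((n : ℝ) ^ 2 * n * n) * 1 := by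
            rw [mul_one]; gcongr
        _ ≤ 2 ^ 36 * ((n : ℝ) ^ 2 * n * n) * m := by gcongr
        _ = _ := by ring
    have h2 : (2 : ℝ) ^ 53 ≤ n ^ 53 := pow_le_pow_left₀ zero_le_two hn2' 53
    push_cast
    calc (N : ℝ) * k * (2 * n ^ 2) ≤ 2 * (2 ^ 36 * (n : ℝ) ^ 4) * n * (2 * n ^ 2) := by
          gcongr
          linarith
      _ = 2 ^ 38 * (n : ℝ) ^ 7 := by ring
      _ ≤ 1 / 16 * 2 ^ 53 * (n : ℝ) ^ 7 := by gcongr; norm_num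
      _ ≤ 1 / 16 * (n : ℝ) ^ 53 * n ^ 7 := by gcongr
      _ = _ := by ring
  · linarith
  · rw [neg_sub, Real.exp_sub, Real.exp_log two_pos, Real.exp_neg, div_eq_mul_inv]
    refine le_of_eq (congrArg (fun x => 2 * (Real.exp x)⁻¹) ?_)
    rw [hD]; field_simp
  · have hR : (2 * (n ^ 60 : ℕ) + 1 : ℝ) ≤ Real.exp (64 * L) := by
      rw [hL, ← Real.log_rpow hn0, Real.exp_log (by positivity)]
      push_cast
      have h1 : (1 : ℝ) ≤ n ^ 60 := one_le_pow₀ (by linarith)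
      have h2 : (2 : ℝ) ^ 4 ≤ n ^ 4 := pow_le_pow_left₀ zero_le_two hn2' 4
      calc (2 * n ^ 60 + 1 : ℝ) ≤ 2 ^ 4 * n ^ 60 := by linarith
        _ ≤ n ^ 4 * n ^ 60 := by gcongr
        _ = (n : ℝ) ^ (64 : ℝ) := by rw [← pow_add]; norm_cast
    have hk2 : (2 * k : ℝ) ≤ Real.exp (2 * k) := by linarith [Real.add_one_le_exp (2 * k : ℝ)]
    have hhalf : Real.exp (-1) ≤ 1 / 2 := by
      rw [Real.exp_neg, ← one_div]
      exact one_div_le_one_div_of_le two_pos (by linarith [Real.add_one_le_exp (1 : ℝ)])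
    calc _ ≤ Real.exp (64 * L) ^ (m * n) * (Real.exp (2 * k) ^ N *
          Real.exp (-((D / 2 ^ 27 - Real.log 2) * N / 2))) := by gcongr
      _ = Real.exp (64 * (m * n * L) + 2 * (k * N) - (D / 2 ^ 27 - Real.log 2) * N / 2) := by
          rw [← Real.exp_nat_mul, ← Real.exp_nat_mul, ← Real.exp_add, ← Real.exp_add]
          push_cast
          ring_nf
      _ ≤ Real.exp (-1) := by
          refine Real.exp_le_exp.2 ?_
          have h1 : 2 ^ 36 * (m * n * L) ≤ D * N := by
            calc 2 ^ 36 * (m * n * L) = D * N0 := by rw [hD, hN0]; field_simp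
              _ ≤ D * N := by gcongr
          have h2 : 2 ^ 74 * k * N ≤ D * N := by gcongr
          have h3 : (1 : ℝ) * N ≤ k * N := by gcongr
          have h4 : Real.log 2 * N ≤ 1 * N := by gcongr; linarith
          have h5 : (1 : ℝ) ≤ m * n * L := by
            rw [mul_assoc]
            exact one_le_mul_of_one_le_of_one_le hm1 (by nlinarith)
          linarith
      _ ≤ 1 / 2 := hhalf

end parameters

lemma exists_orthonormal_rows {m n : ℕ} (S : Submodule ℝ (Fin n → ℝ))
    (hm : m ≤ Module.finrank ℝ S) :
    ∃ U : Matrix (Fin m) (Fin n) ℝ, U * Uᵀ = 1 ∧ ∀ x, rowProj U x ∈ S := by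
  let e := (WithLp.linearEquiv 2 ℝ (Fin n → ℝ)).symm
  let S' : Submodule ℝ (EuclideanSpace ℝ (Fin n)) := S.map e.toLinearMap
  have hS' : Module.finrank ℝ S' = Module.finrank ℝ S := LinearEquiv.finrank_map_eq e S
  obtain ⟨v, hv, hvS⟩ : ∃ v : Fin m → EuclideanSpace ℝ (Fin n),
      Orthonormal ℝ v ∧ ∀ c, v c ∈ S' := by
    let b := stdOrthonormalBasis ℝ S'
    have h := (b.orthonormal.comp_linearIsometry S'.subtypeₗᵢ).comp
      (Fin.castLE (hm.trans hS'.ge)) (Fin.castLE_injective _)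
    exact ⟨_, h, fun c => (b (Fin.castLE (hm.trans hS'.ge) c)).2⟩
  let U : Matrix (Fin m) (Fin n) ℝ := Matrix.of fun c a => v c a
  refine ⟨U, ?_, fun x => ?_⟩
  · ext c c'
    have h := orthonormal_iff_ite.1 hv c c'
    rw [PiLp.inner_apply] at h
    rw [Matrix.mul_apply, Matrix.one_apply, ← h]
    exact Finset.sum_congr rfl fun a _ => mul_comm _ _
  · have hrow : ∀ c, U c ∈ S := by
      intro c
      obtain ⟨y, hy, hyv⟩ := hvS c
      have : U c = y := by
        ext a
        simp [U, ← hyv, e]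
      rwa [this]
    have e : rowProj U x = ∑ c, (U *ᵥ x) c • U c := by
      ext a
      rw [Finset.sum_apply]
      change ∑ c, U c a * (U *ᵥ x) c = ∑ c, (U *ᵥ x) c * U c a
      exact Finset.sum_congr rfl fun c _ => mul_comm _ _
    rw [e]
    exact Submodule.sum_mem _ fun c _ => S.smul_mem _ (hrow c)

/-- Every injective linear map into a space of matrices induces a mixed `ℓ_q(ℓ_p)` norm. -/
lemma exists_normedSpace {E ι κ : Type} [AddCommGroup E] [Module ℝ E] [Fintype ι] [Fintype κ]
    {p q : ℝ} (hp : 1 ≤ p) (hq : 1 ≤ q) (Φ : E →ₗ[ℝ] ι → κ → ℝ) (hΦ : Function.Injective Φ) :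
    ∃ (Y : Type) (_ : NormedAddCommGroup Y) (_ : NormedSpace ℝ Y) (e : Y ≃ₗ[ℝ] E),
      ∀ y, ‖y‖ = lqNorm q fun l => lqNorm p (Φ (e y) l) := by
  have hp0 : 0 < p := by linarith
  have hq0 : 0 < q := by linarith
  let norm : Norm E := ⟨fun x => lqNorm q fun l => lqNorm p (Φ x l)⟩
  have hcore : NormedSpace.Core ℝ E := by
    refine ⟨⟨fun x => lqNorm_nonneg _, fun c x => ?_, fun x y => ?_⟩, fun x => ⟨fun h => ?_, ?_⟩⟩
    · change lqNorm q (fun l => lqNorm p (Φ (c • x) l)) = _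
      have : ∀ l, lqNorm p (Φ (c • x) l) = |c| * lqNorm p (Φ x l) := fun l => by
        rw [← lqNorm_const_mul hp0, map_smul]; rfl
      simp_rw [this]
      rw [lqNorm_const_mul hq0, abs_abs]
      rfl
    · refine le_trans ?_ (lqNorm_add_le hq _ _)
      refine lqNorm_mono_of_nonneg hq0 (fun _ => lqNorm_nonneg _) fun l => ?_
      rw [map_add]
      exact lqNorm_add_le hp _ _
    · refine hΦ ?_
      rw [map_zero]
      ext l i
      have h1 := abs_le_lqNorm hp0 (Φ x l) i
      have h2 := (le_abs_self _).trans (abs_le_lqNorm hq0 (fun l => lqNorm p (Φ x l)) l)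
      exact abs_nonpos_iff.1 (h1.trans (h2.trans h.le))
    · rintro rfl
      change lqNorm q (fun l => lqNorm p (Φ 0 l)) = 0
      have : ∀ l, lqNorm p (Φ 0 l) = 0 := fun l => by
        rw [map_zero]; exact lqNorm_zero hp0
      simp_rw [this]
      exact lqNorm_zero hq0
  let group : NormedAddCommGroup E := NormedAddCommGroup.ofCore hcore
  exact ⟨E, group, NormedSpace.ofCore hcore, LinearEquiv.refl ℝ E, fun _ => rfl⟩

/-- The linear map whose coordinates are the functionals of the block family `G`, followed by the
blocks of repeated coordinates scaled by `η`. -/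
def blockMap {L κ ι : Type*} [Fintype ι] (G : L → κ → ι → ℝ) (η : ℝ) :
    (ι → ℝ) →ₗ[ℝ] L ⊕ ι → κ → ℝ where
  toFun x := Sum.elim (fun l i => G l i ⬝ᵥ x) fun a _ => η * x a
  map_add' x y := by
    ext (l | a) i <;> simp [dotProduct_add, mul_add]
  map_smul' c x := by
    ext (l | a) i <;> simp [mul_left_comm]

section blockMap

variable {L κ ι : Type*} [Fintype ι]

lemma blockMap_injective [Nonempty κ] (G : L → κ → ι → ℝ) {η : ℝ} (hη : η ≠ 0) :
    Function.Injective (blockMap G η) := by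
  intro x y h
  ext a
  have := congrFun (congrFun h (Sum.inr a)) (Classical.arbitrary κ)
  exact mul_left_cancel₀ hη this

lemma lqNorm_blockMap_le [Fintype L] [Fintype κ] [DecidableEq L] [DecidableEq κ] {p q η : ℝ}
    (hp : 1 ≤ p) (hq : 1 ≤ q) (hη : 0 ≤ η) (ω : L × κ → ι → Bool) (j : L) (i : κ) (x : ι → ℝ) :
    (lqNorm q fun l => lqNorm p (blockMap (signBlock ω) η x l)) ≤
      blockNorm q (otherBlock ω (j, i)) x + |signBlock ω j i ⬝ᵥ x| +
        Fintype.card κ * η * ∑ a, |x a| := by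
  have hq0 : 0 < q := by linarith
  let F₁ : L ⊕ ι → ℝ := Sum.elim (fun l => ∑ r, |otherBlock ω (j, i) l r ⬝ᵥ x|) fun _ => 0
  let F₂ : L ⊕ ι → ℝ := Sum.elim (fun l => if l = j then |signBlock ω j i ⬝ᵥ x| else 0)
    fun a => Fintype.card κ * η * |x a|
  have h₁ : lqNorm q F₁ = blockNorm q (otherBlock ω (j, i)) x := by
    simp [F₁, blockNorm, lqNorm, Fintype.sum_sum_type, Real.zero_rpow hq0.ne']
  have h₂ : lqNorm q F₂ ≤ |signBlock ω j i ⬝ᵥ x| + Fintype.card κ * η * ∑ a, |x a| := by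
    refine (lqNorm_le_sum hq _).trans (le_of_eq ?_)
    simp [F₂, Fintype.sum_sum_type, apply_ite abs, Finset.mul_sum, abs_mul, abs_of_nonneg hη]
  rw [add_assoc, ← h₁]
  refine le_trans ?_ (add_le_add_right h₂ _)
  refine le_trans ?_ (lqNorm_add_le hq _ _)
  refine lqNorm_mono_of_nonneg hq0 (fun _ => lqNorm_nonneg _) fun l => ?_
  refine (lqNorm_le_sum hp _).trans (le_of_eq ?_)
  rcases l with l | a
  · have hr : ∀ r, |signBlock ω l r ⬝ᵥ x| = |otherBlock ω (j, i) l r ⬝ᵥ x| +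
        if r = i then (if l = j then |signBlock ω j i ⬝ᵥ x| else 0) else 0 := by
      intro r
      by_cases h : (l, r) = (j, i)
      · obtain ⟨rfl, rfl⟩ := Prod.ext_iff.1 h
        have : otherBlock ω (l, r) l r = 0 := by ext a; simp [otherBlock]
        simp [this]
      · have h1 : otherBlock ω (j, i) l r = signBlock ω l r := by
          ext a; simp only [otherBlock, if_neg h, signBlock]
        rw [h1]
        by_cases hr : r = i
        · have : l ≠ j := fun hl => h (by rw [hr, hl])
          simp [this]
        · simp [hr]
    change ∑ r, |signBlock ω l r ⬝ᵥ x| = _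
    simp_rw [hr, Finset.sum_add_distrib]
    simp [F₁, F₂]
  · change ∑ r : κ, |η * x a| = _
    simp [F₁, F₂, abs_mul, abs_of_nonneg hη, mul_assoc]

end blockMap

/-- A block of vectors which are long inside a subspace and nearly orthogonal to the other vectors
of the family forces a large type constant. -/
lemma le_typeConst_of_block {n m N k : ℕ} {p q p₁ : ℝ} (hp : 1 ≤ p) (hp2 : p ≤ 2) (hq : 2 ≤ q)
    (hp₁ : 1 ≤ p₁) (hp₁2 : p₁ ≤ 2) (hm : 0 < m) (hn : 0 < n) (hk : 0 < k)
    (ω : Fin N × Fin k → Fin n → Bool) {Y : Type} [NormedAddCommGroup Y] [NormedSpace ℝ Y]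
    (e : Y ≃ₗ[ℝ] (Fin n → ℝ))
    (he : ∀ y, ‖y‖ = lqNorm q fun l =>
      lqNorm p (blockMap (signBlock ω) (1 / (8 * (k * n ^ 2) : ℝ)) (e y) l))
    {U : Matrix (Fin m) (Fin n) ℝ} (hU : U * Uᵀ = 1) (S : Submodule ℝ Y)
    (hUS : ∀ x, e.symm (rowProj U x) ∈ S) {j : Fin N}
    (hj : ∀ i, (m : ℝ) / 4 ≤ signBlock ω j i ⬝ᵥ rowProj U (signBlock ω j i) ∧
      blockNorm q (otherBlock ω (j, i)) (rowProj U (signBlock ω j i)) ≤ m / 8) :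
    (1 / 2 : ℝ) * (k : ℝ) ^ (1 / p - 1 / p₁) ≤ typeConst p₁ S := by
  have hm1 : (1 : ℝ) ≤ m := by exact_mod_cast hm
  have hk0 : (0 : ℝ) < k := by exact_mod_cast hk
  have hn1 : (1 : ℝ) ≤ n := by exact_mod_cast hn
  have hn0 : (0 : ℝ) < n := by linarith
  set g : Fin k → Fin n → ℝ := signBlock ω j with hg
  set s : Fin k → ℝ := fun i => g i ⬝ᵥ rowProj U (g i) with hs
  have hs0 : ∀ i, 0 < s i := fun i => lt_of_lt_of_le (by positivity) (hj i).1
  let y : Fin k → S := fun i => (s i)⁻¹ • ⟨e.symm (rowProj U (g i)), hUS _⟩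
  have hy : ∀ i, e (y i : Y) = (s i)⁻¹ • rowProj U (g i) := fun i => by simp [y]
  refine le_typeConst hp hp2 hq
    ((blockMap (signBlock ω) (1 / (8 * (k * n ^ 2) : ℝ))).comp (e.toLinearMap.comp S.subtype))
    (fun x => he x) hp₁ hp₁2 hk (Equiv.refl _) (Sum.inl j) y (fun i => ?_) fun i => ?_
  · have hnorm : ‖e.symm (rowProj U (g i))‖ ≤ 2 * s i := by
      rw [he, LinearEquiv.apply_symm_apply]
      refine (lqNorm_blockMap_le hp (by linarith) (by positivity) ω j i _).trans ?_
      rw [Fintype.card_fin]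
      have hsum : ∑ a, |rowProj U (g i) a| ≤ n * n := by
        refine (Finset.sum_le_card_nsmul _ _ (n : ℝ) fun a _ => ?_).trans (le_of_eq (by simp))
        have h1 := abs_le_lqNorm two_pos (rowProj U (g i)) a
        rw [lqNorm_two] at h1
        have h2 : l2 (g i) ^ 2 = n := l2_sgn_sq _
        have h3 : l2 (g i) ≤ n := abs_le_of_sq_le_sq' (by rw [h2]; nlinarith) hn0.le |>.2
        exact h1.trans ((l2_rowProj_le hU _).trans h3)
      have hscale : k * (1 / (8 * (k * n ^ 2) : ℝ)) * ∑ a, |rowProj U (g i) a| ≤ 1 / 8 := by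
        calc _ ≤ k * (1 / (8 * (k * n ^ 2) : ℝ)) * (n * n) := by gcongr
          _ = 1 / 8 := by field_simp
      have habs : |g i ⬝ᵥ rowProj U (g i)| = s i := abs_of_pos (hs0 i)
      rw [habs]
      linarith [(hj i).1, (hj i).2]
    change ‖(s i)⁻¹ • e.symm (rowProj U (g i))‖ ≤ 2
    rw [norm_smul, Real.norm_of_nonneg (inv_nonneg.2 (hs0 i).le), inv_mul_le_iff₀ (hs0 i)]
    linarith
  · change g i ⬝ᵥ e (y i : Y) = 1
    rw [hy, dotProduct_smul, smul_eq_mul, inv_mul_cancel₀ (hs0 i).ne']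

/-- **Remark after Theorem 2.1.** Let `2 < q < ∞`, `α := (q-2)/(2q+2)`, `1 < p < 2`.
There are a universal `c₁ > 0` and `C = C(p,q)` such that if
`√q n^{1-α}(log n)^{(1-2α)/3} ≤ m₀ ≤ n` and `k ≤ c₁ m₀/(q^{1/2} n^{1-α}(log n)^{(1-2α)/3})`,
then there is an `n`-dimensional normed space `Y` with `T_p(Y) ≤ C` and `C_q(Y) ≤ C` such
that every subspace `Ỹ` of dimension `m ∈ [m₀, n]` satisfies
`T_{p₁}(Ỹ) ≥ (1/2) k^{1/p - 1/p₁}` for every `p₁ ∈ (p, 2)`. -/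
theorem saturation_type_lower_bound :
    ∃ c₁ : ℝ, 0 < c₁ ∧
    ∀ q p : ℝ, 2 < q → 1 < p → p < 2 →
    ∃ C : ℝ,
    ∀ n m₀ k : ℕ, 0 < n → 0 < m₀ → 0 < k →
      Real.sqrt q * (n : ℝ) ^ (1 - (q - 2) / (2 * q + 2)) *
        (Real.log n) ^ ((1 - 2 * ((q - 2) / (2 * q + 2))) / 3) ≤ (m₀ : ℝ) →
      m₀ ≤ n →
      (k : ℝ) ≤ c₁ * (m₀ : ℝ) / (Real.sqrt q * (n : ℝ) ^ (1 - (q - 2) / (2 * q + 2)) *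
        (Real.log n) ^ ((1 - 2 * ((q - 2) / (2 * q + 2))) / 3)) →
    ∃ (Y : Type) (_ : NormedAddCommGroup Y) (_ : NormedSpace ℝ Y),
      Module.finrank ℝ Y = n ∧ typeConst p Y ≤ C ∧ cotypeConst q Y ≤ C ∧
      ∀ m : ℕ, m₀ ≤ m → m ≤ n →
      ∀ Ysub : Submodule ℝ Y, Module.finrank ℝ Ysub = m →
      ∀ p₁ : ℝ, p < p₁ → p₁ < 2 →
        (1 / 2 : ℝ) * (k : ℝ) ^ (1 / p - 1 / p₁) ≤ typeConst p₁ Ysub := by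
  refine ⟨2⁻¹ ^ 37, by positivity, fun q p hq hp hp2 => ⟨max (Real.sqrt q) 4, ?_⟩⟩
  intro n m₀ k hn hm₀ hk _ hmn hkm
  obtain ⟨N, R, d, hN, hR, hM, hRm, hd0, hd, hnum⟩ := exists_parameters hq hn hm₀ hk hmn hkm
  obtain ⟨ω, hω⟩ := exists_signs hq.le hm₀ hmn hN hk hR hM hRm hd0 hd hnum
  have : Nonempty (Fin k) := ⟨⟨0, hk⟩⟩
  have hη : (1 / (8 * (k * n ^ 2) : ℝ)) ≠ 0 := by positivity
  obtain ⟨Y, _, _, e, he⟩ := exists_normedSpace hp.le (by linarith : 1 ≤ q)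
    (blockMap (signBlock ω) (1 / (8 * (k * n ^ 2) : ℝ))) (blockMap_injective _ hη)
  refine ⟨Y, inferInstance, inferInstance, ?_, ?_, ?_, ?_⟩
  · rw [e.finrank_eq, Module.finrank_fin_fun]
  · exact (typeConst_le hp.le hp2.le hq.le ((blockMap (signBlock ω) _).comp e.toLinearMap)
      he).trans (le_max_left _ _)
  · exact (cotypeConst_le hp.le hp2.le hq.le ((blockMap (signBlock ω) _).comp e.toLinearMap)
      he).trans (le_max_right _ _)
  · intro m hm₀m _ S hS p₁ hp₁ hp₁2
    obtain ⟨U, hU, hUS⟩ := exists_orthonormal_rows (m := m₀) (S.map e.toLinearMap)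
      (by rw [LinearEquiv.finrank_map_eq, hS]; exact hm₀m)
    obtain ⟨j, hj⟩ := hω U hU
    refine le_typeConst_of_block hp.le hp2.le hq.le (by linarith) hp₁2.le hm₀ hn hk ω e he hU S
      (fun x => ?_) hj
    obtain ⟨y, hy, hyx⟩ := hUS x
    rw [← hyx]
    simpa using hy
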